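/- Let $\alpha \in (1/3,1/2)$, $p \in (1,\infty]$ with $\alpha > 1/p$. The lifting map $L \colon W^\alpha_p([0,T];\mathbb{R}^d) \to W^\alpha_p([0,T]; G^2(\mathbb{R}^d))$ constructed via the reconstruction operator satisfies: for every $R > 0$ there is $C_R$ such that for all $X, \tilde X$ with $\|X\|_{W^\alpha_p}, \|\tilde X\|_{W^\alpha_p} \le R$, $\rho_{W^\alpha_p}(L(X), L(\tilde X)) \le C_R \|X - \tilde X\|_{W^\alpha_p}$, where $\rho_{W^\alpha_p}(\mathbf{X}^1, \mathbf{X}^2) = \big(\iint |\pi_1(\mathbf{X}^1_{s,t} - \mathbf{X}^2_{s,t})|^p |t-s|^{-\alpha p-1}\big)^{1/p} + \big(\iint |\pi_2(\mathbf{X}^1_{s,t} - \mathbf{X}^2_{s,t})|^{p/2} |t-s|^{-\alpha p-1}\big)^{2/p}$. -/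

import Mathlib

open MeasureTheory Set

variable (d : ℕ)

/-- Membership in the fractional Sobolev path space `W^α_p([0,T]; ℝ^d)`:
continuity together with finiteness of the Gagliardo double integral and of the
`L^p` norm. -/
def InPathSpace (T α p : ℝ) (X : ℝ → EuclideanSpace ℝ (Fin d)) : Prop :=
  ContinuousOn X (Icc 0 T) ∧
    (∫⁻ u in Icc (0:ℝ) T, ∫⁻ v in Icc (0:ℝ) T,
      ENNReal.ofReal (‖X u - X v‖ ^ p / |v - u| ^ (α * p + 1)) < ⊤) ∧
    (∫⁻ u in Icc (0:ℝ) T, ENNReal.ofReal (‖X u‖ ^ p) < ⊤)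

/-- The fractional Sobolev norm of a path (Gagliardo seminorm plus `L^p` norm). -/
noncomputable def pathSobNorm (T α p : ℝ) (X : ℝ → EuclideanSpace ℝ (Fin d)) : ℝ :=
  (∫ u in Icc (0:ℝ) T, ∫ v in Icc (0:ℝ) T,
      ‖X u - X v‖ ^ p / |v - u| ^ (α * p + 1)) ^ (1/p)
    + (∫ u in Icc (0:ℝ) T, ‖X u‖ ^ p) ^ (1/p)

/-- Second-level increment `π₂(𝐗_s⁻¹ ⊗ 𝐗_t)` of the rough path `𝐗_t = (1, a(t), b(t))`. -/
def secondIncr (a : ℝ → EuclideanSpace ℝ (Fin d)) (b : ℝ → Matrix (Fin d) (Fin d) ℝ)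
    (s t : ℝ) : Matrix (Fin d) (Fin d) ℝ :=
  Matrix.of fun i j => b t i j - b s i j - a s i * (a t j - a s j)

/-- The inhomogeneous Sobolev rough path metric `ρ_{W^α_p}` between two rough paths
encoded by their two levels. -/
noncomputable def rhoSob (T α p : ℝ)
    (a₁ : ℝ → EuclideanSpace ℝ (Fin d)) (b₁ : ℝ → Matrix (Fin d) (Fin d) ℝ)
    (a₂ : ℝ → EuclideanSpace ℝ (Fin d)) (b₂ : ℝ → Matrix (Fin d) (Fin d) ℝ) : ℝ :=
  (∫ s in Icc (0:ℝ) T, ∫ t in Icc (0:ℝ) T,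
      ‖(a₁ t - a₁ s) - (a₂ t - a₂ s)‖ ^ p / |t - s| ^ (α * p + 1)) ^ (1/p)
    + (∫ s in Icc (0:ℝ) T, ∫ t in Icc (0:ℝ) T,
        (Real.sqrt (∑ i, ∑ j,
          (secondIncr d a₁ b₁ s t i j - secondIncr d a₂ b₂ s t i j) ^ 2)) ^ (p/2)
          / |t - s| ^ (α * p + 1)) ^ (2/p)


namespace SobLift

noncomputable def phi (z : ℝ) : ℝ := max 0 (6 * z * (1 - z))

lemma phi_nonneg (z : ℝ) : 0 ≤ phi z := le_max_left _ _

lemma phi_le (z : ℝ) : phi z ≤ 6 := by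
  unfold phi
  apply max_le (by norm_num)
  nlinarith [sq_nonneg (z - 1/2)]

lemma phi_zero {z : ℝ} (h : z ≤ 0 ∨ 1 ≤ z) : phi z = 0 := by
  unfold phi
  apply max_eq_left
  rcases h with h | h
  · nlinarith
  · nlinarith

lemma phi_eq {z : ℝ} (h0 : 0 ≤ z) (h1 : z ≤ 1) : phi z = 6 * z * (1 - z) := by
  unfold phi
  apply max_eq_right
  have : 0 ≤ 1 - z := by linarith
  positivity

lemma phi_lip_aux {z w : ℝ} : phi z - phi w ≤ 6 * |z - w| := by
  have hw := phi_nonneg w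
  by_cases hz : z ≤ 0 ∨ 1 ≤ z
  · rw [phi_zero hz]
    have := abs_nonneg (z - w)
    linarith
  push Not at hz
  rw [phi_eq hz.1.le hz.2.le]
  have h1 := le_abs_self (z - w)
  have h2 := neg_abs_le (z - w)
  by_cases hw0 : w ≤ 0
  · rw [phi_zero (Or.inl hw0)]
    nlinarith
  by_cases hw1 : 1 ≤ w
  · rw [phi_zero (Or.inr hw1)]
    nlinarith
  push Not at hw0 hw1
  rw [phi_eq hw0.le hw1.le]
  have : 6 * z * (1 - z) - 6 * w * (1 - w) = 6 * ((z - w) * (1 - z - w)) := by ring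
  rw [this]
  have h3 : (z - w) * (1 - z - w) ≤ |z - w| * 1 := by
    refine (le_abs_self _).trans ?_
    rw [abs_mul]
    gcongr
    rw [abs_le]
    constructor <;> linarith [hz.1, hz.2]
  linarith

lemma phi_lip (z w : ℝ) : |phi z - phi w| ≤ 6 * |z - w| := by
  rw [abs_le]
  have h1 := @phi_lip_aux z w
  have h2 := @phi_lip_aux w z
  rw [abs_sub_comm] at h2
  constructor <;> linarith

lemma phi_cont : Continuous phi := by
  unfold phi
  fun_prop

lemma phi_int {a b : ℝ} (ha : a ≤ 0) (hb : 1 ≤ b) : ∫ z in a..b, phi z = 1 := by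
  have hi : ∀ a b : ℝ, IntervalIntegrable phi volume a b :=
    fun a b => phi_cont.intervalIntegrable a b
  rw [← intervalIntegral.integral_add_adjacent_intervals (hi a 0) (hi 0 b),
    ← intervalIntegral.integral_add_adjacent_intervals (hi 0 1) (hi 1 b)]
  have e1 : ∫ z in a..0, phi z = 0 := by
    rw [intervalIntegral.integral_congr (g := fun _ => (0:ℝ))]
    · simp
    · intro z hz
      rw [uIcc_of_le ha] at hz
      exact phi_zero (Or.inl hz.2)
  have e2 : ∫ z in (1:ℝ)..b, phi z = 0 := by
    rw [intervalIntegral.integral_congr (g := fun _ => (0:ℝ))]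
    · simp
    · intro z hz
      rw [uIcc_of_le hb] at hz
      exact phi_zero (Or.inr hz.1)
  have e3 : ∫ z in (0:ℝ)..1, phi z = 1 := by
    rw [intervalIntegral.integral_congr (g := fun z => 6 * z - 6 * z ^ 2)]
    · rw [intervalIntegral.integral_sub (by apply Continuous.intervalIntegrable; fun_prop)
        (by apply Continuous.intervalIntegrable; fun_prop)]
      rw [intervalIntegral.integral_const_mul (6:ℝ) (fun z : ℝ => z),
        intervalIntegral.integral_const_mul (6:ℝ) (fun z : ℝ => z ^ 2), integral_id, integral_pow]
      norm_num
    · intro z hz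
      rw [uIcc_of_le zero_le_one] at hz
      show phi z = _
      rw [phi_eq hz.1 hz.2]
      ring
  rw [e1, e2, e3]; norm_num

noncomputable def lam (T : ℝ) (n : ℕ) : ℝ := 2 ^ n / T

lemma lam_pos {T : ℝ} (hT : 0 < T) (n : ℕ) : 0 < lam T n := by unfold lam; positivity

lemma lam_succ (T : ℝ) (n : ℕ) : lam T (n+1) = 2 * lam T n := by
  unfold lam; rw [pow_succ]; ring

lemma inv_le_lam {T : ℝ} (hT : 0 < T) (n : ℕ) : 1 / T ≤ lam T n := by
  unfold lam
  gcongr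
  exact one_le_pow₀ (by norm_num)

noncomputable def ker (T : ℝ) (n : ℕ) (t u : ℝ) : ℝ :=
  lam T n * phi (lam T n * u - (lam T n - 1 / T) * t)

lemma ker_nonneg {T : ℝ} (hT : 0 < T) (n : ℕ) (t u : ℝ) : 0 ≤ ker T n t u :=
  mul_nonneg (lam_pos hT n).le (phi_nonneg _)

lemma ker_le {T : ℝ} (hT : 0 < T) (n : ℕ) (t u : ℝ) : ker T n t u ≤ 6 * lam T n := by
  unfold ker
  rw [mul_comm 6]
  have := (lam_pos hT n).le
  gcongr
  exact phi_le _

lemma ker_supp {T : ℝ} (hT : 0 < T) (n : ℕ) {t u : ℝ} (ht : t ∈ Icc 0 T)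
    (h : 1 / lam T n < |u - t|) : ker T n t u = 0 := by
  unfold ker
  rw [phi_zero, mul_zero]
  have hl := lam_pos hT n
  have h1 : 1 < |lam T n * (u - t)| := by
    rw [abs_mul, abs_of_pos hl]
    rw [div_lt_iff₀ hl] at h
    linarith
  have e : lam T n * u - (lam T n - 1 / T) * t = lam T n * (u - t) + t / T := by ring
  have t0 : 0 ≤ t / T := div_nonneg ht.1 hT.le
  have t1 : t / T ≤ 1 := by rw [div_le_one hT]; exact ht.2
  rw [e]
  rcases lt_abs.1 h1 with h | h
  · right; linarith
  · left; linarith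

lemma ker_lip {T : ℝ} (hT : 0 < T) (n : ℕ) (t s u : ℝ) :
    |ker T n t u - ker T n s u| ≤ 6 * lam T n ^ 2 * |t - s| := by
  have hl := lam_pos hT n
  have hl2 := inv_le_lam hT n
  have : 0 < 1 / T := by positivity
  unfold ker
  rw [← mul_sub, abs_mul, abs_of_pos hl]
  have h1 := phi_lip (lam T n * u - (lam T n - 1 / T) * t) (lam T n * u - (lam T n - 1 / T) * s)
  have e : lam T n * u - (lam T n - 1 / T) * t - (lam T n * u - (lam T n - 1 / T) * s)
    = - ((lam T n - 1/T) * (t - s)) := by ring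
  rw [e, abs_neg, abs_mul, abs_of_nonneg (by linarith : 0 ≤ lam T n - 1 / T)] at h1
  have h2 : (lam T n - 1/T) * |t - s| ≤ lam T n * |t - s| := by
    gcongr; linarith
  calc _ ≤ lam T n * (6 * (lam T n * |t - s|)) := by gcongr; linarith
    _ = _ := by ring

lemma ker_cont (T : ℝ) (n : ℕ) : Continuous (fun q : ℝ × ℝ => ker T n q.1 q.2) := by
  unfold ker
  have := phi_cont
  fun_prop

lemma ker_cont_right (T : ℝ) (n : ℕ) (t : ℝ) : Continuous (fun u => ker T n t u) :=
  (ker_cont T n).comp (by fun_prop : Continuous fun u : ℝ => (t, u))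

lemma ker_int {T : ℝ} (hT : 0 < T) (n : ℕ) {t : ℝ} (ht : t ∈ Icc 0 T) :
    ∫ u in Icc 0 T, ker T n t u = 1 := by
  rw [integral_Icc_eq_integral_Ioc, ← intervalIntegral.integral_of_le hT.le]
  unfold ker
  rw [intervalIntegral.integral_const_mul, intervalIntegral.mul_integral_comp_mul_sub]
  have hl2 := inv_le_lam hT n
  have t0 : 0 ≤ t / T := div_nonneg ht.1 hT.le
  have t1 : t / T ≤ 1 := by rw [div_le_one hT]; exact ht.2
  apply phi_int
  · have : 0 ≤ (lam T n - 1 / T) * t := mul_nonneg (by linarith) ht.1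
    linarith
  · have : 0 ≤ (lam T n - 1 / T) * (T - t) := mul_nonneg (by linarith) (by linarith [ht.2])
    have e : lam T n * T - (lam T n - 1 / T) * t = (lam T n - 1/T) * (T - t) + T / T := by ring
    rw [e, div_self hT.ne']
    linarith

/-- weighted average of x near t at scale 1 / lam. -/
noncomputable def av (T : ℝ) (n : ℕ) (x : ℝ → ℝ) (t : ℝ) : ℝ :=
  ∫ u in Icc 0 T, ker T n t u * x u

lemma ker_mul_integrable (T : ℝ) (n : ℕ) {x : ℝ → ℝ} (hx : Continuous x) (t : ℝ) :
    Integrable (fun u => ker T n t u * x u) (volume.restrict (Icc 0 T)) :=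
  ((ker_cont_right T n t).mul hx).continuousOn.integrableOn_compact isCompact_Icc

lemma ker_integrable (T : ℝ) (n : ℕ) (t : ℝ) :
    Integrable (fun u => ker T n t u) (volume.restrict (Icc 0 T)) :=
  (ker_cont_right T n t).continuousOn.integrableOn_compact isCompact_Icc

lemma av_add (T : ℝ) (n : ℕ) {x y : ℝ → ℝ} (hx : Continuous x) (hy : Continuous y) (t : ℝ) :
    av T n (fun u => x u + y u) t = av T n x t + av T n y t := by
  unfold av
  rw [← integral_add (ker_mul_integrable T n hx t) (ker_mul_integrable T n hy t)]
  simp only [mul_add]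

lemma av_smul (T : ℝ) (n : ℕ) (c : ℝ) (x : ℝ → ℝ) (t : ℝ) :
    av T n (fun u => c * x u) t = c * av T n x t := by
  unfold av
  rw [← integral_const_mul]
  congr 1; ext u; ring

lemma av_sub_const {T : ℝ} (hT : 0 < T) (n : ℕ) {x : ℝ → ℝ} (hx : Continuous x) {t : ℝ}
    (ht : t ∈ Icc 0 T) (c : ℝ) :
    av T n x t - c = ∫ u in Icc 0 T, ker T n t u * (x u - c) := by
  simp only [mul_sub]
  rw [integral_sub (ker_mul_integrable T n hx t) ((ker_integrable T n t).mul_const c),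
    integral_mul_const, ker_int hT n ht, one_mul]
  rfl

lemma av_cont (T : ℝ) (n : ℕ) {x : ℝ → ℝ} (hx : Continuous x) : Continuous (av T n x) := by
  unfold av
  apply continuous_parametric_integral_of_continuous (s := Icc 0 T)
    (f := fun t u => ker T n t u * x u) _ isCompact_Icc
  exact (ker_cont T n).mul (hx.comp continuous_snd)

lemma av_abs_sub_le {T : ℝ} (hT : 0 < T) (n : ℕ) {x : ℝ → ℝ} (hx : Continuous x) {t : ℝ}
    (ht : t ∈ Icc 0 T) (c S : ℝ) (hS : ∀ u ∈ Icc 0 T, |u - t| ≤ 1 / lam T n → |x u - c| ≤ S) :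
    |av T n x t - c| ≤ S := by
  rw [av_sub_const hT n hx ht c]
  have : ∫ u in Icc 0 T, ker T n t u * S = S := by
    rw [integral_mul_const, ker_int hT n ht, one_mul]
  rw [← Real.norm_eq_abs]
  conv_rhs => rw [← this]
  apply norm_integral_le_of_norm_le ((ker_integrable T n t).mul_const S)
  rw [ae_restrict_iff' measurableSet_Icc]
  refine Filter.Eventually.of_forall fun u hu => ?_
  rw [norm_mul, Real.norm_of_nonneg (ker_nonneg hT n t u)]
  by_cases h : |u - t| ≤ 1 / lam T n
  · exact mul_le_mul_of_nonneg_left (hS u hu h) (ker_nonneg hT n t u)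
  · rw [ker_supp hT n ht (not_le.1 h)]; simp

lemma lam_tendsto (T : ℝ) :
    Filter.Tendsto (fun n => 1 / lam T n) Filter.atTop (nhds 0) := by
  have : (fun n => 1 / lam T n) = fun n => T * (1/2)^n := by
    ext n; unfold lam; rw [one_div_div, one_div, inv_pow]; rfl
  rw [this]
  simpa using (tendsto_pow_atTop_nhds_zero_of_lt_one (by norm_num : (0:ℝ) ≤ 1/2)
    (by norm_num)).const_mul T

lemma av_tendsto {T : ℝ} (hT : 0 < T) {x : ℝ → ℝ} (hx : Continuous x) {t : ℝ}
    (ht : t ∈ Icc 0 T) : Filter.Tendsto (fun n => av T n x t) Filter.atTop (nhds (x t)) := by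
  rw [Metric.tendsto_atTop]
  intro ε hε
  obtain ⟨δ, hδ, h⟩ := Metric.continuousAt_iff.1 hx.continuousAt (ε/2) (half_pos hε)
  obtain ⟨N, hN⟩ := Metric.tendsto_atTop.1 (lam_tendsto T) δ hδ
  refine ⟨N, fun n hn => ?_⟩
  rw [Real.dist_eq]
  refine lt_of_le_of_lt (av_abs_sub_le hT n hx ht (x t) (ε/2) fun u hu hut => ?_) (half_lt_self hε)
  have h1 := hN n hn
  rw [Real.dist_eq, sub_zero] at h1
  have h2 := h (x := u) (by rw [Real.dist_eq]; exact (hut.trans (le_abs_self _)).trans_lt h1)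
  rw [Real.dist_eq] at h2
  exact h2.le

lemma av_zero_const (T : ℝ) (x : ℝ → ℝ) (s t : ℝ) : av T 0 x s = av T 0 x t := by
  unfold av ker lam
  simp

noncomputable def dl (T : ℝ) (n : ℕ) (x : ℝ → ℝ) (t : ℝ) : ℝ := av T (n+1) x t - av T n x t

noncomputable def para (T : ℝ) (x y : ℝ → ℝ) (t : ℝ) : ℝ := ∑' n, av T n x t * dl T n y t

end SobLift
namespace SobLift

noncomputable def JJ (T : ℝ) (n : ℕ) (t u : ℝ) : ENNReal :=
  if |u - t| ≤ 2 / lam T n then ENNReal.ofReal (lam T n) else 0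

noncomputable def EE (T : ℝ) (n : ℕ) (x : ℝ → ℝ) (t : ℝ) : ENNReal :=
  ∫⁻ u in Icc 0 T, JJ T n t u * ‖x u - x t‖ₑ

noncomputable def MM (T : ℝ) (n : ℕ) (h : ℝ) : ENNReal := ENNReal.ofReal (min 1 (lam T n * |h|))

lemma lintegral_Icc_mono {T : ℝ} {f g : ℝ → ENNReal} (h : ∀ u ∈ Icc 0 T, f u ≤ g u) :
    ∫⁻ u in Icc 0 T, f u ≤ ∫⁻ u in Icc 0 T, g u :=
  setLIntegral_mono' measurableSet_Icc h

lemma JJ_meas (T : ℝ) (n : ℕ) : Measurable (fun q : ℝ × ℝ => JJ T n q.1 q.2) := by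
  unfold JJ
  apply Measurable.ite _ measurable_const measurable_const
  apply measurableSet_le <;> fun_prop

lemma JJ_meas_right (T : ℝ) (n : ℕ) (t : ℝ) : Measurable (fun u => JJ T n t u) :=
  (JJ_meas T n).comp (measurable_const.prodMk measurable_id)

lemma integrand_meas (T : ℝ) (n : ℕ) {x : ℝ → ℝ} (hx : Continuous x) :
    Measurable (fun q : ℝ × ℝ => JJ T n q.1 q.2 * ‖x q.2 - x q.1‖ₑ) := by
  apply (JJ_meas T n).mul
  have := hx.measurable
  fun_prop

lemma EE_meas (T : ℝ) (n : ℕ) {x : ℝ → ℝ} (hx : Continuous x) : Measurable (EE T n x) := by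
  unfold EE
  exact (integrand_meas T n hx).lintegral_prod_right'

lemma ker_le_JJ {T : ℝ} (hT : 0 < T) {n k : ℕ} (h1 : lam T n ≤ lam T k)
    (h2 : lam T k ≤ 2 * lam T n) {t : ℝ} (ht : t ∈ Icc 0 T) (u : ℝ) :
    ‖ker T k t u‖ₑ ≤ 12 * JJ T n t u := by
  unfold JJ
  have hl := lam_pos hT n
  have hk := lam_pos hT k
  split_ifs with h
  · rw [Real.enorm_of_nonneg (ker_nonneg hT k t u),
      show (12 : ENNReal) = ENNReal.ofReal 12 by simp, ← ENNReal.ofReal_mul (by norm_num)]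
    apply ENNReal.ofReal_le_ofReal
    linarith [ker_le hT k t u]
  · rw [ker_supp hT k ht]
    · simp
    · refine lt_of_le_of_lt ?_ (not_le.1 h)
      calc 1 / lam T k ≤ 1 / lam T n := by gcongr
        _ ≤ 2 / lam T n := by gcongr; norm_num

lemma ker_diff_le {T : ℝ} (hT : 0 < T) {n k : ℕ} (h1 : lam T n ≤ lam T k)
    (h2 : lam T k ≤ 2 * lam T n) {t s : ℝ} (ht : t ∈ Icc 0 T) (hs : s ∈ Icc 0 T)
    (hts : lam T n * |t - s| ≤ 1) (u : ℝ) :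
    ‖ker T k t u - ker T k s u‖ₑ ≤ 24 * ENNReal.ofReal (lam T n * |t - s|) * JJ T n s u := by
  unfold JJ
  have hl := lam_pos hT n
  have hk := lam_pos hT k
  split_ifs with h
  · rw [Real.enorm_eq_ofReal_abs, 
      show (24 : ENNReal) = ENNReal.ofReal 24 by simp, ← ENNReal.ofReal_mul (by norm_num),
      ← ENNReal.ofReal_mul (by positivity)]
    apply ENNReal.ofReal_le_ofReal
    refine (ker_lip hT k t s u).trans ?_
    calc 6 * lam T k ^ 2 * |t - s| ≤ 6 * (2 * lam T n) ^ 2 * |t - s| := by gcongr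
      _ = _ := by ring
  · push Not at h
    have hb : 1 / lam T k ≤ 1 / lam T n := by gcongr
    have e : 2 / lam T n = 1 / lam T n + 1 / lam T n := by ring
    have h0 : 0 < 1 / lam T n := by positivity
    have h3 : |t - s| ≤ 1 / lam T n := by rw [le_div_iff₀ hl]; linarith
    rw [ker_supp hT k ht, ker_supp hT k hs]
    · simp
    · linarith
    · have := abs_sub_le u t s
      linarith

lemma av_sub_le {T : ℝ} (hT : 0 < T) {n k : ℕ} (h1 : lam T n ≤ lam T k)
    (h2 : lam T k ≤ 2 * lam T n) {x : ℝ → ℝ} (hx : Continuous x) {t : ℝ} (ht : t ∈ Icc 0 T) :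
    ‖av T k x t - x t‖ₑ ≤ 12 * EE T n x t := by
  rw [av_sub_const hT k hx ht]
  refine (enorm_integral_le_lintegral_enorm _).trans ?_
  unfold EE
  rw [← lintegral_const_mul' _ _ (by norm_num)]
  apply lintegral_Icc_mono
  intro u hu
  rw [enorm_mul, ← mul_assoc]
  gcongr
  exact ker_le_JJ hT h1 h2 ht u

lemma av_diff_le {T : ℝ} (hT : 0 < T) {n k : ℕ} (h1 : lam T n ≤ lam T k)
    (h2 : lam T k ≤ 2 * lam T n) {x : ℝ → ℝ} (hx : Continuous x) {t s : ℝ} (ht : t ∈ Icc 0 T)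
    (hs : s ∈ Icc 0 T) (hts : lam T n * |t - s| ≤ 1) :
    ‖av T k x t - av T k x s‖ₑ ≤ 24 * ENNReal.ofReal (lam T n * |t - s|) * EE T n x s := by
  have hxc : Continuous fun u => x u - x s := by fun_prop
  have e : av T k x t - av T k x s
      = ∫ u in Icc 0 T, (ker T k t u - ker T k s u) * (x u - x s) := by
    simp only [sub_mul (ker T k t _)]
    rw [integral_sub (ker_mul_integrable T k hxc t) (ker_mul_integrable T k hxc s),
      ← av_sub_const hT k hx ht, ← av_sub_const hT k hx hs]
    ring
  rw [e]
  refine (enorm_integral_le_lintegral_enorm _).trans ?_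
  unfold EE
  rw [← lintegral_const_mul' _ _ (ENNReal.mul_ne_top (by norm_num) ENNReal.ofReal_ne_top)]
  apply lintegral_Icc_mono
  intro u hu
  rw [enorm_mul, ← mul_assoc]
  gcongr
  exact ker_diff_le hT h1 h2 ht hs hts u

lemma enorm_sub_le_add (a b : ℝ) : ‖a - b‖ₑ ≤ ‖a‖ₑ + ‖b‖ₑ := enorm_sub_le

lemma dl_le {T : ℝ} (hT : 0 < T) (n : ℕ) {x : ℝ → ℝ} (hx : Continuous x) {t : ℝ}
    (ht : t ∈ Icc 0 T) : ‖dl T n x t‖ₑ ≤ 24 * EE T n x t := by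
  have hl := lam_pos hT n
  have e : dl T n x t = (av T (n+1) x t - x t) - (av T n x t - x t) := by unfold dl; ring
  rw [e]
  refine (enorm_sub_le_add _ _).trans ?_
  have h1 := av_sub_le hT (n := n) (k := n) le_rfl (by linarith) hx ht
  have h2 := av_sub_le hT (n := n) (k := n+1) (by rw [lam_succ]; linarith) (lam_succ T n).le hx ht
  refine (add_le_add h2 h1).trans (le_of_eq ?_)
  ring

lemma dl_diff_le {T : ℝ} (hT : 0 < T) (n : ℕ) {x : ℝ → ℝ} (hx : Continuous x) {t s : ℝ}
    (ht : t ∈ Icc 0 T) (hs : s ∈ Icc 0 T) (hts : lam T n * |t - s| ≤ 1) :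
    ‖dl T n x t - dl T n x s‖ₑ ≤ 48 * ENNReal.ofReal (lam T n * |t - s|) * EE T n x s := by
  have hl := lam_pos hT n
  have e : dl T n x t - dl T n x s
    = (av T (n+1) x t - av T (n+1) x s) - (av T n x t - av T n x s) := by unfold dl; ring
  rw [e]
  refine (enorm_sub_le_add _ _).trans ?_
  have h1 := av_diff_le hT (n := n) (k := n) le_rfl (by linarith) hx ht hs hts
  have h2 := av_diff_le hT (n := n) (k := n+1) (by rw [lam_succ]; linarith) (lam_succ T n).le
    hx ht hs hts
  refine (add_le_add h2 h1).trans (le_of_eq ?_)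
  ring

noncomputable def trm (T : ℝ) (n : ℕ) (x y : ℝ → ℝ) (s t : ℝ) : ℝ :=
  (av T n x t - x s) * dl T n y t - (av T n x s - x s) * dl T n y s

lemma trm_le {T : ℝ} (hT : 0 < T) (n : ℕ) {x y : ℝ → ℝ} (hx : Continuous x) (hy : Continuous y)
    {t s : ℝ} (ht : t ∈ Icc 0 T) (hs : s ∈ Icc 0 T) :
    ‖trm T n x y s t‖ₑ ≤ 3000 * MM T n (t - s) *
      (EE T n x s * EE T n y s + EE T n x t * EE T n y t + ‖x t - x s‖ₑ * EE T n y t) := by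
  have hl := lam_pos hT n
  have h2l : lam T n ≤ 2 * lam T n := by linarith
  by_cases hts : lam T n * |t - s| ≤ 1
  · have hM : MM T n (t - s) = ENNReal.ofReal (lam T n * |t - s|) := by
      unfold MM; rw [min_eq_right hts]
    have hM1 : MM T n (t - s) ≤ 1 := by
      rw [hM, ← ENNReal.ofReal_one]; exact ENNReal.ofReal_le_ofReal hts
    have e : trm T n x y s t = (av T n x s - x s) * (dl T n y t - dl T n y s)
        + (av T n x t - av T n x s) * ((dl T n y t - dl T n y s) + dl T n y s) := by
      unfold trm; ring
    have a1 := av_sub_le hT (n := n) (k := n) le_rfl h2l hx hs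
    have a2 := dl_diff_le hT n hy ht hs hts
    have a3 := av_diff_le hT (n := n) (k := n) le_rfl h2l hx ht hs hts
    have a4 := dl_le hT n hy hs
    rw [← hM] at a2 a3
    set M := MM T n (t - s)
    set a := EE T n x s
    set b := EE T n y s
    have a5 : ‖dl T n y t - dl T n y s + dl T n y s‖ₑ ≤ 72 * b := by
      refine (enorm_add_le _ _).trans ?_
      calc _ ≤ 48 * M * b + 24 * b := add_le_add a2 a4
        _ ≤ 48 * 1 * b + 24 * b := by gcongr
        _ = _ := by ring
    rw [e]
    calc _ ≤ 12 * a * (48 * M * b) + 24 * M * a * (72 * b) := by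
          refine (enorm_add_le _ _).trans ?_
          rw [enorm_mul, enorm_mul]
          gcongr
      _ = 2304 * M * (a * b) := by ring
      _ ≤ 3000 * M * (a * b) := by gcongr; norm_num
      _ ≤ _ := by
        gcongr
        rw [add_assoc]
        exact le_self_add
  · push Not at hts
    have hM : MM T n (t - s) = 1 := by
      unfold MM; rw [min_eq_left hts.le]; simp
    have a1 := av_sub_le hT (n := n) (k := n) le_rfl h2l hx hs
    have a2 := av_sub_le hT (n := n) (k := n) le_rfl h2l hx ht
    have a3 := dl_le hT n hy hs
    have a4 := dl_le hT n hy ht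
    have a5 : ‖av T n x t - x s‖ₑ ≤ 12 * EE T n x t + ‖x t - x s‖ₑ := by
      have : av T n x t - x s = (av T n x t - x t) + (x t - x s) := by ring
      rw [this]
      refine (enorm_add_le _ _).trans ?_
      gcongr
    rw [hM]
    unfold trm
    refine (enorm_sub_le_add _ _).trans ?_
    rw [enorm_mul, enorm_mul]
    calc _ ≤ (12 * EE T n x t + ‖x t - x s‖ₑ) * (24 * EE T n y t)
          + (12 * EE T n x s) * (24 * EE T n y s) := by gcongr
      _ = 288 * (EE T n x s * EE T n y s) + 288 * (EE T n x t * EE T n y t)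
          + 24 * (‖x t - x s‖ₑ * EE T n y t) := by ring
      _ ≤ 3000 * (EE T n x s * EE T n y s) + 3000 * (EE T n x t * EE T n y t)
          + 3000 * (‖x t - x s‖ₑ * EE T n y t) := by
            gcongr <;> norm_num
      _ = _ := by ring

noncomputable def hk (γ s t : ℝ) : ENNReal := ENNReal.ofReal (|t - s| ^ (-γ))

lemma hk_meas (γ : ℝ) : Measurable (fun q : ℝ × ℝ => hk γ q.1 q.2) := by
  unfold hk; fun_prop

noncomputable def GG (T p γ : ℝ) (x : ℝ → ℝ) : ENNReal :=
  ∫⁻ s in Icc 0 T, ∫⁻ t in Icc 0 T, ‖x s - x t‖ₑ ^ p * hk γ s t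

lemma ker_lint {T : ℝ} (hT : 0 < T) (n : ℕ) {t : ℝ} (ht : t ∈ Icc 0 T) :
    ∫⁻ u in Icc 0 T, ‖ker T n t u‖ₑ = 1 := by
  simp only [fun u => Real.enorm_of_nonneg (ker_nonneg hT n t u)]
  rw [← ofReal_integral_eq_lintegral_ofReal (ker_integrable T n t)
    (Filter.Eventually.of_forall fun u => ker_nonneg hT n t u), ker_int hT n ht]
  simp

lemma young_aux {p δ z : ℝ} (hp : 1 < p) (hδ : 0 < δ) (hz : 0 ≤ z) :
    z ≤ δ + δ ^ (1 - p) * z ^ p := by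
  rcases le_or_gt z δ with h | h
  · have : 0 ≤ δ ^ (1 - p) * z ^ p := by positivity
    linarith
  · have hz' : 0 < z := hδ.trans h
    have h1 : z ^ (1 - p) ≤ δ ^ (1 - p) :=
      Real.rpow_le_rpow_of_nonpos hδ h.le (by linarith)
    have h2 : z ^ (1 - p) * z ^ p = z := by
      rw [← Real.rpow_add hz']; simp
    have h3 : z ^ (1 - p) * z ^ p ≤ δ ^ (1 - p) * z ^ p := by gcongr
    linarith

lemma kk_aux {T p γ : ℝ} (hT : 0 < T) (hp : 1 < p) (hγ : 0 < γ) (n : ℕ) {δ : ℝ} (hδ : 0 < δ)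
    {t : ℝ} (ht : t ∈ Icc 0 T) (x : ℝ → ℝ) (u v : ℝ) :
    ‖ker T (n+1) t v‖ₑ * (‖ker T n t u‖ₑ * ‖x v - x u‖ₑ) ≤
      ‖ker T (n+1) t v‖ₑ * (‖ker T n t u‖ₑ * ENNReal.ofReal δ) +
      ENNReal.ofReal (72 * 2 ^ γ * lam T n ^ (2 - γ) * δ ^ (1 - p)) *
        (‖x v - x u‖ₑ ^ p * hk γ v u) := by
  have hl := lam_pos hT n
  have k1 := ker_nonneg hT (n+1) t v
  have k2 := ker_nonneg hT n t u
  unfold hk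
  rw [Real.enorm_of_nonneg k1, Real.enorm_of_nonneg k2, Real.enorm_eq_ofReal_abs,
    ENNReal.ofReal_rpow_of_nonneg (abs_nonneg _) (by linarith),
    ← ENNReal.ofReal_mul k2, ← ENNReal.ofReal_mul k2, ← ENNReal.ofReal_mul k1,
    ← ENNReal.ofReal_mul k1, ← ENNReal.ofReal_mul (by positivity),
    ← ENNReal.ofReal_mul (by positivity), ← ENNReal.ofReal_add (by positivity) (by positivity)]
  apply ENNReal.ofReal_le_ofReal
  set z := |x v - x u| with hz
  have hz0 : 0 ≤ z := abs_nonneg _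
  have hpos : 0 ≤ 72 * 2 ^ γ * lam T n ^ (2 - γ) * δ ^ (1 - p) * (z ^ p * |u - v| ^ (-γ)) := by
    positivity
  have hd : 0 ≤ ker T (n+1) t v * (ker T n t u * δ) := by positivity
  by_cases h1 : ker T (n+1) t v = 0
  · rw [h1] at hd ⊢; simp only [zero_mul] at *; linarith
  by_cases h2 : ker T n t u = 0
  · rw [h2] at hd ⊢; simp only [zero_mul, mul_zero] at *; linarith
  rcases eq_or_ne u v with huv | huv
  · have : z = 0 := by rw [hz, huv]; simp
    rw [this] at hpos ⊢
    simp only [mul_zero]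
    linarith
  have b1 : |v - t| ≤ 1 / lam T n := by
    by_contra h
    push Not at h
    refine h1 (ker_supp hT _ ht (lt_of_le_of_lt ?_ h))
    rw [lam_succ]
    gcongr
    linarith
  have b2 : |u - t| ≤ 1 / lam T n := by
    by_contra h
    push Not at h
    exact h2 (ker_supp hT _ ht h)
  have huv' : 0 < |u - v| := abs_pos.2 (sub_ne_zero.2 huv)
  have b3 : |u - v| ≤ 2 / lam T n := by
    have := abs_sub_le u t v
    rw [abs_sub_comm t v] at this
    have e : 2 / lam T n = 1 / lam T n + 1 / lam T n := by ring
    linarith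
  have b4 : 1 ≤ 2 ^ γ * lam T n ^ (-γ) * |u - v| ^ (-γ) := by
    have : (2 / lam T n) ^ (-γ) ≤ |u - v| ^ (-γ) :=
      Real.rpow_le_rpow_of_nonpos huv' b3 (by linarith)
    calc (1:ℝ) = 2 ^ γ * lam T n ^ (-γ) * (2 / lam T n) ^ (-γ) := by
          rw [Real.div_rpow (by norm_num) hl.le, Real.rpow_neg (by norm_num : (0:ℝ) ≤ 2)]
          have : (2:ℝ) ^ γ ≠ 0 := by positivity
          have : lam T n ^ (-γ) ≠ 0 := by positivity
          field_simp
      _ ≤ _ := by gcongr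
  have y := young_aux hp hδ hz0
  have c1 := ker_le hT (n+1) t v
  have c2 := ker_le hT n t u
  rw [lam_succ] at c1
  have e2 : lam T n ^ (2 - γ) = lam T n ^ 2 * lam T n ^ (-γ) := by
    rw [sub_eq_add_neg, Real.rpow_add hl]; norm_num
  calc ker T (n+1) t v * (ker T n t u * z)
      ≤ ker T (n+1) t v * (ker T n t u * (δ + δ ^ (1 - p) * z ^ p)) := by gcongr
    _ = ker T (n+1) t v * (ker T n t u * δ)
        + ker T (n+1) t v * ker T n t u * (δ ^ (1 - p) * z ^ p) * 1 := by ring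
    _ ≤ ker T (n+1) t v * (ker T n t u * δ)
        + (6 * (2 * lam T n)) * (6 * lam T n) * (δ ^ (1 - p) * z ^ p)
          * (2 ^ γ * lam T n ^ (-γ) * |u - v| ^ (-γ)) := by
        gcongr
    _ = _ := by rw [e2]; ring

lemma dl_unif {T p γ : ℝ} (hT : 0 < T) (hp : 1 < p) (hγ : 0 < γ) (n : ℕ) {δ : ℝ} (hδ : 0 < δ)
    {t : ℝ} (ht : t ∈ Icc 0 T) {x : ℝ → ℝ} (hx : Continuous x) :
    ‖dl T n x t‖ₑ ≤ ENNReal.ofReal δ +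
      ENNReal.ofReal (72 * 2 ^ γ * lam T n ^ (2 - γ) * δ ^ (1 - p)) * GG T p γ x := by
  have s1 : ‖dl T n x t‖ₑ ≤ ∫⁻ v in Icc 0 T, ∫⁻ u in Icc 0 T,
      ‖ker T (n+1) t v‖ₑ * (‖ker T n t u‖ₑ * ‖x v - x u‖ₑ) := by
    unfold dl
    rw [av_sub_const hT (n+1) hx ht]
    refine (enorm_integral_le_lintegral_enorm _).trans ?_
    apply lintegral_Icc_mono
    intro v hv
    rw [enorm_mul, lintegral_const_mul' _ _ (by simp), enorm_sub_rev, av_sub_const hT n hx ht]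
    gcongr
    refine (enorm_integral_le_lintegral_enorm _).trans ?_
    apply lintegral_Icc_mono
    intro u hu
    rw [enorm_mul, enorm_sub_rev (x u)]
  refine s1.trans ?_
  refine (lintegral_mono fun v => lintegral_mono fun u => kk_aux hT hp hγ n hδ ht x u v).trans ?_
  have m1 : ∀ n, Measurable fun u => ‖ker T n t u‖ₑ := fun n =>
    (ker_cont_right T n t).measurable.enorm
  have e1 : ∀ v, ∫⁻ u in Icc 0 T, (‖ker T (n+1) t v‖ₑ * (‖ker T n t u‖ₑ * ENNReal.ofReal δ) +
      ENNReal.ofReal (72 * 2 ^ γ * lam T n ^ (2 - γ) * δ ^ (1 - p)) *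
        (‖x v - x u‖ₑ ^ p * hk γ v u)) = ‖ker T (n+1) t v‖ₑ * ENNReal.ofReal δ +
      ENNReal.ofReal (72 * 2 ^ γ * lam T n ^ (2 - γ) * δ ^ (1 - p)) *
        ∫⁻ u in Icc 0 T, (‖x v - x u‖ₑ ^ p * hk γ v u) := by
    intro v
    rw [lintegral_add_left (((m1 n).mul_const _).const_mul _),
      lintegral_const_mul' _ _ (by simp), lintegral_mul_const' _ _ (by simp), ker_lint hT n ht,
      one_mul, lintegral_const_mul' _ _ (by simp)]
  simp only [e1]
  rw [lintegral_add_left ((m1 (n+1)).mul_const _), lintegral_mul_const' _ _ (by simp),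
    ker_lint hT _ ht, one_mul, lintegral_const_mul' _ _ (by simp)]
  rfl

lemma dl_bound {T p γ : ℝ} (hT : 0 < T) (hp : 1 < p) (hγ : 2 < γ) 
    {x : ℝ → ℝ} (hx : Continuous x) (hG : GG T p γ x ≠ ⊤) :
    ∃ u : ℕ → ℝ, Summable u ∧ ∀ n, ∀ t ∈ Icc 0 T, ‖dl T n x t‖ ≤ u n := by
  set κ := (γ - 2) / p with hκ
  have hp0 : 0 < p := by linarith
  have hκ0 : 0 < κ := by apply div_pos <;> linarith
  refine ⟨fun n => (1 + 72 * 2 ^ γ * (GG T p γ x).toReal) * lam T n ^ (-κ), ?_, ?_⟩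
  · apply Summable.mul_left
    have : ∀ n, lam T n ^ (-κ) = (2 ^ (-κ)) ^ n * (T ^ (-κ))⁻¹ := by
      intro n
      unfold lam
      rw [Real.div_rpow (by positivity) hT.le, ← Real.rpow_natCast, ← Real.rpow_natCast,
        ← Real.rpow_mul (by norm_num), ← Real.rpow_mul (by norm_num), mul_comm (n:ℝ)]
      rfl
    simp only [this]
    apply Summable.mul_right
    apply summable_geometric_of_lt_one (by positivity)
    exact Real.rpow_lt_one_of_one_lt_of_neg (by norm_num) (by linarith)
  · intro n t ht
    have hl := lam_pos hT n
    have h := dl_unif hT hp (by linarith : 0 < γ) n (δ := lam T n ^ (-κ)) (by positivity) ht hx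
    have e : lam T n ^ (2 - γ) * (lam T n ^ (-κ)) ^ (1 - p) = lam T n ^ (-κ) := by
      rw [← Real.rpow_mul hl.le, ← Real.rpow_add hl]
      congr 1
      rw [hκ]; field_simp; ring
    rw [mul_assoc _ (lam T n ^ (2 - γ)), e, ← ENNReal.ofReal_toReal hG,
      ← ENNReal.ofReal_mul (by positivity), ← ENNReal.ofReal_add (by positivity) (by positivity),
      ← ofReal_norm, ENNReal.ofReal_le_ofReal_iff (by positivity)] at h
    refine h.trans (le_of_eq ?_)
    ring

lemma para_bound {T p γ : ℝ} (hT : 0 < T) (hp : 1 < p) (hγ : 2 < γ)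
    {x y : ℝ → ℝ} (hx : Continuous x) (hy : Continuous y) (hG : GG T p γ y ≠ ⊤) : ∃ u : ℕ → ℝ, Summable u ∧
    ∀ n, ∀ t ∈ Icc 0 T, ‖av T n x t * dl T n y t‖ ≤ u n := by
  obtain ⟨u, hu, hb⟩ := dl_bound hT hp hγ hy hG
  obtain ⟨S, hS⟩ := isCompact_Icc.exists_bound_of_continuousOn (s := Icc 0 T) hx.continuousOn
  refine ⟨fun n => S * u n, hu.mul_left _, fun n t ht => ?_⟩
  rw [norm_mul]
  have h1 : ‖av T n x t‖ ≤ S := by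
    have := av_abs_sub_le hT n hx ht 0 S (fun u hu _ => by simpa using hS u hu)
    simpa using this
  exact mul_le_mul h1 (hb n t ht) (norm_nonneg _) ((norm_nonneg _).trans h1)

lemma para_cont {T p γ : ℝ} (hT : 0 < T) (hp : 1 < p) (hγ : 2 < γ)
    {x y : ℝ → ℝ} (hx : Continuous x) (hy : Continuous y) (hG : GG T p γ y ≠ ⊤) : ContinuousOn (para T x y) (Icc 0 T) := by
  obtain ⟨u, hu, hb⟩ := para_bound hT hp hγ hx hy hG
  unfold para
  apply continuousOn_tsum _ hu hb
  intro n
  unfold dl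
  exact ((av_cont T n hx).mul ((av_cont T (n+1) hy).sub (av_cont T n hy))).continuousOn

lemma para_summable {T p γ : ℝ} (hT : 0 < T) (hp : 1 < p) (hγ : 2 < γ)
    {x y : ℝ → ℝ} (hx : Continuous x) (hy : Continuous y) (hG : GG T p γ y ≠ ⊤) {t : ℝ} (ht : t ∈ Icc 0 T) : Summable fun n => av T n x t * dl T n y t := by
  obtain ⟨u, hu, hb⟩ := para_bound hT hp hγ hx hy hG
  exact Summable.of_norm_bounded hu (fun n => hb n t ht)

lemma dl_hasSum {T p γ : ℝ} (hT : 0 < T) (hp : 1 < p) (hγ : 2 < γ)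
    {y : ℝ → ℝ} (hy : Continuous y) (hG : GG T p γ y ≠ ⊤) {t : ℝ} (ht : t ∈ Icc 0 T) :
    HasSum (fun n => dl T n y t) (y t - av T 0 y t) := by
  obtain ⟨u, hu, hb⟩ := dl_bound hT hp hγ hy hG
  have hs : Summable (fun n => dl T n y t) := Summable.of_norm_bounded hu (fun n => hb n t ht)
  rw [hs.hasSum_iff_tendsto_nat]
  have : ∀ n, ∑ i ∈ Finset.range n, dl T i y t = av T n y t - av T 0 y t := by
    intro n
    unfold dl
    exact Finset.sum_range_sub (fun n => av T n y t) n
  simp only [this]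
  exact (av_tendsto hT hy ht).sub_const _

lemma trm_hasSum {T p γ : ℝ} (hT : 0 < T) (hp : 1 < p) (hγ : 2 < γ)
    {x y : ℝ → ℝ} (hx : Continuous x) (hy : Continuous y) (hG : GG T p γ y ≠ ⊤) {s t : ℝ} (hs : s ∈ Icc 0 T) (ht : t ∈ Icc 0 T) :
    HasSum (fun n => trm T n x y s t) (para T x y t - para T x y s - x s * (y t - y s)) := by
  have h1 := (para_summable hT hp hγ hx hy hG ht).hasSum
  have h2 := (para_summable hT hp hγ hx hy hG hs).hasSum
  have h3 := (dl_hasSum hT hp hγ hy hG ht).mul_left (x s)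
  have h4 := (dl_hasSum hT hp hγ hy hG hs).mul_left (x s)
  have h5 := ((h1.sub h2).sub h3).add h4
  rw [av_zero_const T y s t] at h5
  have ef : (fun n => trm T n x y s t) = fun b => av T b x t * dl T b y t
      - av T b x s * dl T b y s - x s * dl T b y t + x s * dl T b y s := by
    ext n; unfold trm; ring
  have ev : para T x y t - para T x y s - x s * (y t - y s) =
      ∑' (b : ℕ), av T b x t * dl T b y t - ∑' (b : ℕ), av T b x s * dl T b y s
        - x s * (y t - av T 0 y t) + x s * (y s - av T 0 y t) := by
    unfold para; ring
  rw [ef, ev]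
  exact h5

lemma rem_le {T p γ : ℝ} (hT : 0 < T) (hp : 1 < p) (hγ : 2 < γ)
    {x y : ℝ → ℝ} (hx : Continuous x) (hy : Continuous y) (hG : GG T p γ y ≠ ⊤) {s t : ℝ} (hs : s ∈ Icc 0 T) (ht : t ∈ Icc 0 T) :
    ‖para T x y t - para T x y s - x s * (y t - y s)‖ₑ ≤ ∑' n, 3000 * MM T n (t - s) *
      (EE T n x s * EE T n y s + EE T n x t * EE T n y t + ‖x t - x s‖ₑ * EE T n y t) := by
  have h := trm_hasSum hT hp hγ hx hy hG hs ht
  rw [← h.tsum_eq]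
  refine (enorm_tsum_le_tsum_enorm).trans ?_
  exact ENNReal.tsum_le_tsum fun n => trm_le hT n hx hy ht hs

end SobLift
namespace SobLift

/-! ### geometric sums -/

lemma geom_int {a : ℝ} (ha : 0 < a) : Summable fun k : ℤ => ((2:ℝ) ^ (-a)) ^ k.natAbs := by
  have hq : Summable fun k : ℕ => ((2:ℝ) ^ (-a)) ^ k :=
    summable_geometric_of_lt_one (by positivity)
      (Real.rpow_lt_one_of_one_lt_of_neg (by norm_num) (by linarith))
  apply Summable.of_nat_of_neg
  · simpa using hq
  · simpa using hq

lemma geom_sum {a : ℝ} (ha : 0 < a) : ∃ C : ENNReal, C ≠ ⊤ ∧ ∀ T h : ℝ, 0 < T → 0 < h →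
    ∑' n : ℕ, ENNReal.ofReal (min ((lam T n * h) ^ a) ((lam T n * h) ^ (-a))) ≤ C := by
  refine ⟨∑' k : ℤ, ENNReal.ofReal (2 ^ a * ((2:ℝ) ^ (-a)) ^ k.natAbs), ?_, ?_⟩
  · exact ((geom_int ha).mul_left _).tsum_ofReal_ne_top
  · intro T h hT hh
    obtain ⟨N, hN1, hN2⟩ := exists_mem_Ico_zpow (div_pos hh hT) (one_lt_two : (1:ℝ) < 2)
    have key : ∀ n : ℕ, ENNReal.ofReal (min ((lam T n * h) ^ a) ((lam T n * h) ^ (-a))) ≤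
        (fun k : ℤ => ENNReal.ofReal (2 ^ a * ((2:ℝ) ^ (-a)) ^ k.natAbs)) ((n:ℤ) + N) := by
      intro n
      apply ENNReal.ofReal_le_ofReal
      have hl := lam_pos hT n
      have hr : 0 < lam T n * h := by positivity
      have e : lam T n * h = 2 ^ (n:ℤ) * (h / T) := by
        unfold lam; rw [zpow_natCast]; ring
      have l1 : (2:ℝ) ^ ((n:ℤ) + N) ≤ lam T n * h := by
        rw [e, zpow_add₀ (by norm_num)]
        gcongr
      have l2 : lam T n * h ≤ (2:ℝ) ^ ((n:ℤ) + N + 1) := by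
        rw [e, add_assoc, zpow_add₀ (by norm_num)]
        gcongr
      set k := (n:ℤ) + N
      have e2 : ((2:ℝ) ^ (-a)) ^ k.natAbs = 2 ^ (-a * (k.natAbs : ℝ)) := by
        rw [← Real.rpow_natCast, ← Real.rpow_mul (by norm_num)]
      rw [e2, ← Real.rpow_add (by norm_num)]
      rcases le_total 0 k with hk | hk
      · refine (min_le_right _ _).trans ?_
        have : (k.natAbs : ℝ) = (k : ℝ) := by
          rw [← Int.cast_natCast, Int.natAbs_of_nonneg hk]
        rw [this]
        calc (lam T n * h) ^ (-a) ≤ ((2:ℝ) ^ k) ^ (-a) :=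
              Real.rpow_le_rpow_of_nonpos (by positivity) l1 (by linarith)
          _ = 2 ^ (-a * k) := by
              rw [← Real.rpow_intCast, ← Real.rpow_mul (by norm_num)]; ring_nf
          _ ≤ _ := Real.rpow_le_rpow_of_exponent_le (by norm_num) (by linarith)
      · refine (min_le_left _ _).trans ?_
        have : (k.natAbs : ℝ) = -(k : ℝ) := by
          rw [← Int.cast_natCast, Int.ofNat_natAbs_of_nonpos hk]; simp
        rw [this]
        calc (lam T n * h) ^ a ≤ ((2:ℝ) ^ (k+1)) ^ a := by gcongr
          _ = 2 ^ (a + -a * -(k:ℝ)) := by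
              rw [← Real.rpow_intCast, ← Real.rpow_mul (by norm_num)]; push_cast; ring_nf
          _ ≤ _ := le_rfl
    refine (ENNReal.tsum_le_tsum key).trans ?_
    apply ENNReal.tsum_comp_le_tsum_of_injective
    intro m n hmn
    simpa using hmn

lemma min_aux {β r : ℝ} (hβ0 : 0 < β) (hβ1 : β < 1) (hr : 0 < r) :
    min 1 r * r ^ (-β) ≤ min (r ^ (min β (1 - β))) (r ^ (-(min β (1 - β)))) := by
  have h1 : min β (1 - β) ≤ β := min_le_left _ _
  have h2 : min β (1 - β) ≤ 1 - β := min_le_right _ _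
  have h3 : 0 < min β (1 - β) := lt_min hβ0 (by linarith)
  rcases le_total r 1 with h | h
  · rw [min_eq_right h]
    have e : r * r ^ (-β) = r ^ (1 - β) := by
      rw [sub_eq_add_neg, Real.rpow_add hr, Real.rpow_one]
    rw [e]
    apply le_min <;> apply Real.rpow_le_rpow_of_exponent_ge hr h <;> linarith
  · rw [min_eq_left h, one_mul]
    apply le_min <;> apply Real.rpow_le_rpow_of_exponent_le h <;> linarith

lemma MM_sum {T β : ℝ} (hT : 0 < T) (hβ0 : 0 < β) (hβ1 : β < 1) :
    ∃ C : ENNReal, C ≠ ⊤ ∧ ∀ h : ℝ, h ≠ 0 →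
      ∑' n : ℕ, MM T n h * ENNReal.ofReal (lam T n ^ (-β)) ≤ C * ENNReal.ofReal (|h| ^ β) := by
  obtain ⟨C, hC, hS⟩ := geom_sum (lt_min hβ0 (by linarith) : 0 < min β (1 - β))
  refine ⟨C, hC, fun h hh => ?_⟩
  have hh' : 0 < |h| := abs_pos.2 hh
  calc _ ≤ ∑' n : ℕ, ENNReal.ofReal (min ((lam T n * |h|) ^ (min β (1 - β)))
          ((lam T n * |h|) ^ (-(min β (1 - β))))) * ENNReal.ofReal (|h| ^ β) := by
        apply ENNReal.tsum_le_tsum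
        intro n
        have hl := lam_pos hT n
        have hr : 0 < lam T n * |h| := by positivity
        unfold MM
        rw [← ENNReal.ofReal_mul (by positivity), ← ENNReal.ofReal_mul (by positivity)]
        apply ENNReal.ofReal_le_ofReal
        have := min_aux hβ0 hβ1 hr
        calc min 1 (lam T n * |h|) * lam T n ^ (-β)
            = min 1 (lam T n * |h|) * (lam T n * |h|) ^ (-β) * |h| ^ β := by
              rw [Real.mul_rpow hl.le hh'.le, Real.rpow_neg hh'.le]
              have : |h| ^ β ≠ 0 := by positivity
              field_simp
          _ ≤ _ := by gcongr
    _ = (∑' n : ℕ, ENNReal.ofReal (min ((lam T n * |h|) ^ (min β (1 - β)))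
          ((lam T n * |h|) ^ (-(min β (1 - β)))))) * ENNReal.ofReal (|h| ^ β) :=
        ENNReal.tsum_mul_right
    _ ≤ _ := by gcongr; exact hS T |h| hT hh'

lemma JJ_sum {T γ : ℝ} (hT : 0 < T) (hγ : 0 < γ) :
    ∃ C : ENNReal, C ≠ ⊤ ∧ ∀ s u : ℝ, s ≠ u →
      ∑' n : ℕ, ENNReal.ofReal (lam T n ^ (γ - 1)) * JJ T n s u ≤ C * hk γ s u := by
  obtain ⟨C, hC, hS⟩ := geom_sum hγ
  refine ⟨ENNReal.ofReal (4 ^ γ) * C, ENNReal.mul_ne_top ENNReal.ofReal_ne_top hC,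
    fun s u hsu => ?_⟩
  have hh' : 0 < |u - s| := abs_pos.2 (sub_ne_zero.2 hsu.symm)
  set h := |u - s|
  calc _ ≤ ∑' n : ℕ, ENNReal.ofReal (4 ^ γ) * ENNReal.ofReal (min ((lam T n * h) ^ γ)
          ((lam T n * h) ^ (-γ))) * hk γ s u := by
        apply ENNReal.tsum_le_tsum
        intro n
        have hl := lam_pos hT n
        have hr : 0 < lam T n * h := by positivity
        unfold JJ
        split_ifs with hle
        · unfold hk
          rw [← ENNReal.ofReal_mul (by positivity), ← ENNReal.ofReal_mul (by positivity),
            ← ENNReal.ofReal_mul (by positivity)]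
          apply ENNReal.ofReal_le_ofReal
          have hr2 : lam T n * h ≤ 2 := by
            rw [le_div_iff₀ hl] at hle; linarith
          have e1 : lam T n ^ (γ - 1) * lam T n = (lam T n * h) ^ γ * h ^ (-γ) := by
            rw [Real.mul_rpow hl.le hh'.le, Real.rpow_neg hh'.le, Real.rpow_sub_one hl.ne']
            have : h ^ γ ≠ 0 := by positivity
            field_simp
          rw [e1]
          show _ ≤ 4 ^ γ * _ * h ^ (-γ)
          gcongr
          set r := lam T n * h
          have b1 : r ^ γ ≤ 4 ^ γ * r ^ γ := by
            have : (1:ℝ) ≤ 4 ^ γ := Real.one_le_rpow (by norm_num) hγ.le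
            have := Real.rpow_nonneg hr.le γ
            nlinarith
          have b2 : r ^ γ ≤ 4 ^ γ * r ^ (-γ) := by
            rw [Real.rpow_neg hr.le, ← div_eq_mul_inv, le_div_iff₀ (by positivity),
              ← Real.mul_rpow hr.le hr.le]
            gcongr
            nlinarith
          rcases min_choice (r ^ γ) (r ^ (-γ)) with e | e <;> rw [e] <;> assumption
        · simp
    _ = ENNReal.ofReal (4 ^ γ) * (∑' n : ℕ, ENNReal.ofReal (min ((lam T n * h) ^ γ)
          ((lam T n * h) ^ (-γ)))) * hk γ s u := by
        rw [ENNReal.tsum_mul_right, ENNReal.tsum_mul_left]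
    _ ≤ _ := by gcongr; exact hS T h hT hh'

/-! ### the kernel integral -/

lemma base_int {β : ℝ} (hβ0 : 0 < β) (hβ1 : β < 1) :
    ∫⁻ z : ℝ, ENNReal.ofReal (min 1 |z| * |z| ^ (-β - 1)) ≠ ⊤ := by
  set g : ℝ → ENNReal := fun z => ENNReal.ofReal (min 1 |z| * |z| ^ (-β - 1)) with hg
  have h1 : ∫⁻ z in Ioc 0 1, g z ≠ ⊤ := by
    have hi : IntegrableOn (fun z : ℝ => z ^ (-β)) (Ioc 0 1) := by
      rw [← intervalIntegrable_iff_integrableOn_Ioc_of_le zero_le_one]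
      exact intervalIntegral.intervalIntegrable_rpow' (by linarith)
    refine ne_top_of_le_ne_top hi.lintegral_lt_top.ne ?_
    apply setLIntegral_mono' measurableSet_Ioc
    intro z hz
    apply ENNReal.ofReal_le_ofReal
    rw [abs_of_pos hz.1, min_eq_right hz.2, Real.rpow_sub_one hz.1.ne']
    have := hz.1.ne'
    exact le_of_eq (by field_simp)
  have h2 : ∫⁻ z in Ioi 1, g z ≠ ⊤ := by
    have hi : IntegrableOn (fun z : ℝ => z ^ (-β - 1)) (Ioi 1) :=
      integrableOn_Ioi_rpow_of_lt (by linarith) one_pos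
    refine ne_top_of_le_ne_top hi.lintegral_lt_top.ne ?_
    apply setLIntegral_mono' measurableSet_Ioi
    intro z hz
    apply ENNReal.ofReal_le_ofReal
    have hz' : (1:ℝ) < z := hz
    rw [abs_of_pos (by linarith), min_eq_left hz'.le, one_mul]
  have h3 : ∫⁻ z in Ioi 0, g z ≠ ⊤ := by
    rw [← Ioc_union_Ioi_eq_Ioi (zero_le_one : (0:ℝ) ≤ 1)]
    exact ne_top_of_le_ne_top (ENNReal.add_ne_top.2 ⟨h1, h2⟩) (lintegral_union_le _ _ _)
  have h4 : ∫⁻ z in Iio 0, g z ≠ ⊤ := by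
    have e : ∫⁻ z in Iio 0, g z = ∫⁻ z in Ioi 0, g z := by
      have := (Measure.measurePreserving_neg (volume : Measure ℝ)).setLIntegral_comp_preimage_emb
        (MeasurableEquiv.neg ℝ).measurableEmbedding g (Ioi 0)
      rw [← this]
      have e2 : (Neg.neg : ℝ → ℝ) ⁻¹' Ioi 0 = Iio 0 := by ext; simp
      rw [e2]
      simp [hg]
    rw [e]; exact h3
  have hu : (univ : Set ℝ) = Iio 0 ∪ ({0} ∪ Ioi 0) := by
    ext z; simp
  rw [← setLIntegral_univ, hu]
  refine ne_top_of_le_ne_top ?_ ((lintegral_union_le _ _ _).trans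
    (add_le_add le_rfl (lintegral_union_le _ _ _)))
  refine ENNReal.add_ne_top.2 ⟨h4, ENNReal.add_ne_top.2 ⟨?_, h3⟩⟩
  rw [Measure.restrict_singleton]
  simp

lemma MM_int {T β : ℝ} (hT : 0 < T) (hβ0 : 0 < β) (hβ1 : β < 1) :
    ∃ C : ENNReal, C ≠ ⊤ ∧ ∀ (n : ℕ) (s : ℝ),
      ∫⁻ t in Icc 0 T, MM T n (t - s) * hk (β + 1) s t ≤ C * ENNReal.ofReal (lam T n ^ β) := by
  refine ⟨_, base_int hβ0 hβ1, fun n s => ?_⟩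
  have hl := lam_pos hT n
  set g : ℝ → ENNReal := fun z => ENNReal.ofReal (min 1 |z| * |z| ^ (-β - 1)) with hg
  have gm : Measurable g := by rw [hg]; fun_prop
  have e1 : ∀ t, MM T n (t - s) * hk (β + 1) s t
      = ENNReal.ofReal (lam T n ^ (β + 1)) * g (lam T n * (t - s)) := by
    intro t
    unfold MM hk
    rw [hg, ← ENNReal.ofReal_mul (by positivity), ← ENNReal.ofReal_mul (by positivity)]
    congr 1
    rw [abs_mul, abs_of_pos hl, Real.mul_rpow hl.le (abs_nonneg _), neg_add']
    have : lam T n ^ (β + 1) * lam T n ^ (-β - 1) = 1 := by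
      rw [← Real.rpow_add hl]; simp
    calc _ = (lam T n ^ (β + 1) * lam T n ^ (-β - 1)) *
        (min 1 (lam T n * |t - s|) * |t - s| ^ (-β - 1)) := by rw [this, one_mul]
      _ = _ := by ring
  calc _ ≤ ∫⁻ t, MM T n (t - s) * hk (β + 1) s t := setLIntegral_le_lintegral _ _
    _ = ENNReal.ofReal (lam T n ^ (β + 1)) * ∫⁻ t, g (lam T n * (t - s)) := by
        simp only [e1]; rw [lintegral_const_mul' _ _ (by simp)]
    _ = ENNReal.ofReal (lam T n ^ (β + 1)) * ∫⁻ t, g (lam T n * t) := by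
        rw [lintegral_sub_right_eq_self (fun t => g (lam T n * t)) s]
    _ = ENNReal.ofReal (lam T n ^ (β + 1)) * (ENNReal.ofReal (lam T n)⁻¹ * ∫⁻ t, g t) := by
        rw [← lintegral_map gm (measurable_const_mul (lam T n)),
          Real.map_volume_mul_left hl.ne', lintegral_smul_measure, abs_of_pos (inv_pos.2 hl)]
        rfl
    _ = _ := by
        rw [← mul_assoc, ← ENNReal.ofReal_mul (by positivity), mul_comm]
        congr 2
        rw [Real.rpow_add hl, Real.rpow_one]
        field_simp
  
/-! ### Jensen -/

lemma jensen {A : Type*} [MeasurableSpace A] (μ : Measure A) {p : ℝ} (hp : 1 < p)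
    {w f : A → ENNReal} (hw : Measurable w) (hf : Measurable f) :
    (∫⁻ a, w a * f a ∂μ) ^ p ≤ (∫⁻ a, w a ∂μ) ^ (p - 1) * ∫⁻ a, w a * f a ^ p ∂μ := by
  have hp0 : 0 < p := by linarith
  have hc : p.HolderConjugate (p / (p - 1)) := Real.HolderConjugate.conjExponent hp
  have h := ENNReal.lintegral_mul_le_Lp_mul_Lq μ hc.symm
    (f := fun a => w a ^ (1 - 1 / p)) (g := fun a => w a ^ (1 / p) * f a)
    (by fun_prop) (by fun_prop)
  have hp1 : 1 / p < 1 := by rw [div_lt_one hp0]; exact hp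
  have hp2 : 0 < 1 / p := by positivity
  have e1 : ∀ a, ((fun a => w a ^ (1 - 1 / p)) * (fun a => w a ^ (1 / p) * f a)) a
      = w a * f a := by
    intro a
    simp only [Pi.mul_apply]
    rw [← mul_assoc, ← ENNReal.rpow_add_of_nonneg _ _ (by linarith) hp2.le]
    simp
  have hpm : p - 1 ≠ 0 := by linarith
  have e2 : ∀ a, (w a ^ (1 - 1 / p)) ^ (p / (p - 1)) = w a := by
    intro a
    rw [← ENNReal.rpow_mul]
    have : (1 - 1 / p) * (p / (p - 1)) = 1 := by field_simp
    rw [this, ENNReal.rpow_one]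
  have e3 : ∀ a, (w a ^ (1 / p) * f a) ^ p = w a * f a ^ p := by
    intro a
    rw [ENNReal.mul_rpow_of_nonneg _ _ hp0.le, ← ENNReal.rpow_mul]
    have : 1 / p * p = 1 := by field_simp
    rw [this, ENNReal.rpow_one]
  simp only [e1, e2, e3] at h
  have h' := ENNReal.rpow_le_rpow h hp0.le
  rw [ENNReal.mul_rpow_of_nonneg _ _ hp0.le, ← ENNReal.rpow_mul, ← ENNReal.rpow_mul] at h'
  have x1 : 1 / (p / (p - 1)) * p = p - 1 := by field_simp
  have x2 : 1 / p * p = 1 := by field_simp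
  rwa [x1, x2, ENNReal.rpow_one] at h'

lemma jensen_tsum {p : ℝ} (hp : 1 < p) (w f : ℕ → ENNReal) :
    (∑' n, w n * f n) ^ p ≤ (∑' n, w n) ^ (p - 1) * ∑' n, w n * f n ^ p := by
  have := jensen Measure.count hp (w := w) (f := f) measurable_from_nat measurable_from_nat
  simpa only [lintegral_count] using this

lemma MM_meas (T : ℝ) (n : ℕ) : Measurable (MM T n) := by
  unfold MM; fun_prop

lemma schur {T β q : ℝ} (hT : 0 < T) (hβ0 : 0 < β) (hβ1 : β < 1) (hq : 1 < q) :
    ∃ C : ENNReal, C ≠ ⊤ ∧ ∀ F : ℕ → ℝ → ENNReal, (∀ n, Measurable (F n)) →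
      ∫⁻ s in Icc 0 T, ∫⁻ t in Icc 0 T, (∑' n, MM T n (t - s) * F n s) ^ q * hk (β * q + 1) s t
        ≤ C * ∑' n, ENNReal.ofReal (lam T n ^ (β * q)) * ∫⁻ s in Icc 0 T, F n s ^ q := by
  obtain ⟨C1, hC1, h1⟩ := MM_sum hT hβ0 hβ1
  obtain ⟨C2, hC2, h2⟩ := MM_int hT hβ0 hβ1
  refine ⟨C1 ^ (q - 1) * C2, ENNReal.mul_ne_top
    (ENNReal.rpow_ne_top_of_nonneg (by linarith) hC1) hC2, fun F hF => ?_⟩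
  have key : ∀ s t, (∑' n, MM T n (t - s) * F n s) ^ q * hk (β * q + 1) s t ≤
      ∑' n, C1 ^ (q - 1) * (ENNReal.ofReal (lam T n ^ (β * (q - 1))) * F n s ^ q *
        (MM T n (t - s) * hk (β + 1) s t)) := by
    intro s t
    rcases eq_or_ne t s with rfl | hts
    · have : hk (β * q + 1) t t = 0 := by
        unfold hk
        have : -(β * q + 1) ≠ 0 := by
          have : 0 < β * q := by positivity
          linarith
        rw [sub_self, abs_zero, Real.zero_rpow this, ENNReal.ofReal_zero]
      rw [this, mul_zero]; exact zero_le
    have hh : t - s ≠ 0 := sub_ne_zero.2 hts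
    have hh' : 0 < |t - s| := abs_pos.2 hh
    have j := jensen_tsum hq (fun n => MM T n (t - s) * ENNReal.ofReal (lam T n ^ (-β)))
      (fun n => ENNReal.ofReal (lam T n ^ β) * F n s)
    have e1 : ∀ n, MM T n (t - s) * ENNReal.ofReal (lam T n ^ (-β)) *
        (ENNReal.ofReal (lam T n ^ β) * F n s) = MM T n (t - s) * F n s := by
      intro n
      have hl := lam_pos hT n
      have : ENNReal.ofReal (lam T n ^ (-β)) * ENNReal.ofReal (lam T n ^ β) = 1 := by
        rw [← ENNReal.ofReal_mul (by positivity), ← Real.rpow_add hl]; simp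
      calc _ = MM T n (t - s) * (ENNReal.ofReal (lam T n ^ (-β)) * ENNReal.ofReal (lam T n ^ β))
          * F n s := by ring
        _ = _ := by rw [this, mul_one]
    have e2 : ∀ n, MM T n (t - s) * ENNReal.ofReal (lam T n ^ (-β)) *
        (ENNReal.ofReal (lam T n ^ β) * F n s) ^ q
        = MM T n (t - s) * (ENNReal.ofReal (lam T n ^ (β * (q - 1))) * F n s ^ q) := by
      intro n
      have hl := lam_pos hT n
      rw [ENNReal.mul_rpow_of_nonneg _ _ (by linarith),
        ENNReal.ofReal_rpow_of_nonneg (by positivity) (by linarith), mul_assoc, ← mul_assoc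
          (ENNReal.ofReal (lam T n ^ (-β))), ← ENNReal.ofReal_mul (by positivity),
          ← Real.rpow_mul hl.le, ← Real.rpow_add hl]
      congr 4
      ring
    simp only [e1, e2] at j
    have e3 : ENNReal.ofReal (|t - s| ^ β) ^ (q - 1) * hk (β * q + 1) s t = hk (β + 1) s t := by
      unfold hk
      rw [ENNReal.ofReal_rpow_of_nonneg (by positivity) (by linarith),
        ← ENNReal.ofReal_mul (by positivity), ← Real.rpow_mul hh'.le, ← Real.rpow_add hh']
      congr 2; ring
    calc _ ≤ (C1 * ENNReal.ofReal (|t - s| ^ β)) ^ (q - 1) * (∑' n, MM T n (t - s) *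
          (ENNReal.ofReal (lam T n ^ (β * (q - 1))) * F n s ^ q)) * hk (β * q + 1) s t := by
          gcongr
          refine j.trans ?_
          gcongr
          exact h1 _ hh
      _ = C1 ^ (q - 1) * (∑' n, MM T n (t - s) *
          (ENNReal.ofReal (lam T n ^ (β * (q - 1))) * F n s ^ q)) *
          (ENNReal.ofReal (|t - s| ^ β) ^ (q - 1) * hk (β * q + 1) s t) := by
          rw [ENNReal.mul_rpow_of_nonneg _ _ (by linarith)]; ring
      _ = _ := by
          rw [e3, mul_assoc, ← ENNReal.tsum_mul_right, ← ENNReal.tsum_mul_left]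
          apply tsum_congr
          intro n
          ring
  refine (lintegral_mono fun s => lintegral_mono fun t => key s t).trans ?_
  have mk : ∀ s, Measurable fun t => hk (β + 1) s t := fun s =>
    (hk_meas _).comp (measurable_const.prodMk measurable_id)
  have mM : ∀ n s, Measurable fun t => MM T n (t - s) := fun n s =>
    (MM_meas T n).comp (measurable_id.sub_const s)
  have inner : ∀ s, ∫⁻ t in Icc 0 T, ∑' n, C1 ^ (q - 1) *
      (ENNReal.ofReal (lam T n ^ (β * (q - 1))) * F n s ^ q *
        (MM T n (t - s) * hk (β + 1) s t)) ≤ ∑' n, C1 ^ (q - 1) * C2 *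
      (ENNReal.ofReal (lam T n ^ (β * q)) * F n s ^ q) := by
    intro s
    rw [lintegral_tsum fun n => by
      have := mk s
      have := mM n s
      fun_prop]
    apply ENNReal.tsum_le_tsum
    intro n
    have hl := lam_pos hT n
    rw [lintegral_const_mul _ (by have := mk s; have := mM n s; fun_prop),
      lintegral_const_mul _ (by have := mk s; have := mM n s; fun_prop)]
    calc _ ≤ C1 ^ (q - 1) * (ENNReal.ofReal (lam T n ^ (β * (q - 1))) * F n s ^ q *
        (C2 * ENNReal.ofReal (lam T n ^ β))) := by gcongr; exact h2 n s
      _ = C1 ^ (q - 1) * C2 * (ENNReal.ofReal (lam T n ^ (β * (q - 1))) *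
        ENNReal.ofReal (lam T n ^ β) * F n s ^ q) := by ring
      _ = _ := by
        rw [← ENNReal.ofReal_mul (by positivity), ← Real.rpow_add hl]
        congr 5
        ring
  refine (lintegral_mono inner).trans ?_
  have mF : ∀ n, Measurable fun s => F n s ^ q := fun n => (hF n).pow_const q
  rw [lintegral_tsum fun n => by have := mF n; fun_prop, ← ENNReal.tsum_mul_left]
  apply le_of_eq
  apply tsum_congr
  intro n
  rw [lintegral_const_mul _ (by have := mF n; fun_prop), lintegral_const_mul _ (mF n)]

lemma JJ_int {T : ℝ} (hT : 0 < T) (n : ℕ) (t : ℝ) : ∫⁻ u in Icc 0 T, JJ T n t u ≤ 4 := by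
  have hl := lam_pos hT n
  refine (setLIntegral_le_lintegral _ _).trans ?_
  have : ∀ u, JJ T n t u = (Metric.closedBall t (2 / lam T n)).indicator
      (fun _ => ENNReal.ofReal (lam T n)) u := by
    intro u
    unfold JJ
    simp only [indicator, Metric.mem_closedBall, Real.dist_eq]
  simp only [this]
  rw [lintegral_indicator Metric.isClosed_closedBall.measurableSet, lintegral_const,
    Measure.restrict_apply_univ, Real.volume_closedBall, ← ENNReal.ofReal_mul hl.le]
  have : lam T n * (2 * (2 / lam T n)) = 4 := by field_simp; norm_num
  rw [this]; simp

lemma EE_sum {T p γ : ℝ} (hT : 0 < T) (hp : 1 < p) (hγ : 0 < γ) :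
    ∃ C : ENNReal, C ≠ ⊤ ∧ ∀ x : ℝ → ℝ, Continuous x →
      ∑' n, ENNReal.ofReal (lam T n ^ (γ - 1)) * ∫⁻ s in Icc 0 T, EE T n x s ^ p
        ≤ C * GG T p γ x := by
  obtain ⟨C, hC, hJ⟩ := JJ_sum hT hγ
  have h4 : (4 : ENNReal) ^ (p - 1) ≠ ⊤ :=
    ENNReal.rpow_ne_top_of_nonneg (by linarith) (by norm_num)
  refine ⟨4 ^ (p - 1) * C, ENNReal.mul_ne_top h4 hC, fun x hx => ?_⟩
  have hxm := hx.measurable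
  have mj : ∀ n, Measurable (fun q : ℝ × ℝ => JJ T n q.1 q.2 * ‖x q.2 - x q.1‖ₑ ^ p) := by
    intro n
    apply (JJ_meas T n).mul
    fun_prop
  have mj2 : ∀ n s, Measurable (fun u => JJ T n s u * ‖x u - x s‖ₑ ^ p) := fun n s =>
    (mj n).comp (measurable_const.prodMk measurable_id)
  have b1 : ∀ n s, EE T n x s ^ p ≤ 4 ^ (p - 1) * ∫⁻ u in Icc 0 T, JJ T n s u * ‖x u - x s‖ₑ ^ p := by
    intro n s
    unfold EE
    refine (jensen _ hp (JJ_meas_right T n s) (by fun_prop)).trans ?_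
    gcongr
    exact JJ_int hT n s
  calc _ ≤ ∑' n, ENNReal.ofReal (lam T n ^ (γ - 1)) * ∫⁻ s in Icc 0 T, 4 ^ (p - 1) *
        ∫⁻ u in Icc 0 T, JJ T n s u * ‖x u - x s‖ₑ ^ p := by
        gcongr with n s
        exact b1 n s
    _ = 4 ^ (p - 1) * ∑' n, ∫⁻ s in Icc 0 T, 
        ∫⁻ u in Icc 0 T, ENNReal.ofReal (lam T n ^ (γ - 1)) * (JJ T n s u * ‖x u - x s‖ₑ ^ p) := by
        rw [← ENNReal.tsum_mul_left]
        apply tsum_congr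
        intro n
        rw [lintegral_const_mul' _ _ h4]
        have : ∀ s, ∫⁻ u in Icc 0 T, ENNReal.ofReal (lam T n ^ (γ - 1)) *
            (JJ T n s u * ‖x u - x s‖ₑ ^ p) = ENNReal.ofReal (lam T n ^ (γ - 1)) * ∫⁻ u in Icc 0 T,
            (JJ T n s u * ‖x u - x s‖ₑ ^ p) := fun s => lintegral_const_mul' _ _ (by simp)
        simp only [this]
        rw [lintegral_const_mul' _ _ (by simp)]
        ring
    _ = 4 ^ (p - 1) * ∫⁻ s in Icc 0 T, ∫⁻ u in Icc 0 T, ∑' n,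
          ENNReal.ofReal (lam T n ^ (γ - 1)) * (JJ T n s u * ‖x u - x s‖ₑ ^ p) := by
        congr 1
        rw [← lintegral_tsum]
        · congr 1
          ext s
          rw [← lintegral_tsum]
          intro n
          exact ((mj2 n s).const_mul _).aemeasurable
        · intro n
          exact (((mj n).const_mul _).lintegral_prod_right').aemeasurable
    _ ≤ 4 ^ (p - 1) * ∫⁻ s in Icc 0 T, ∫⁻ u in Icc 0 T, C * (‖x s - x u‖ₑ ^ p * hk γ s u) := by
        gcongr with s u
        rcases eq_or_ne s u with rfl | hsu
        · have : (0:ENNReal) ^ p = 0 := ENNReal.zero_rpow_of_pos (by linarith)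
          simp [this]
        · simp only [← mul_assoc]
          rw [ENNReal.tsum_mul_right, enorm_sub_rev]
          calc _ ≤ (C * hk γ s u) * ‖x s - x u‖ₑ ^ p := by gcongr; exact hJ s u hsu
            _ = _ := by ring
    _ = _ := by
        unfold GG
        simp only [lintegral_const_mul' C _ hC]
        ring

end SobLift
namespace SobLift

lemma add_rpow_le' (a b : ENNReal) {q : ℝ} (hq : 0 ≤ q) :
    (a + b) ^ q ≤ 2 ^ q * (a ^ q + b ^ q) := by
  rcases le_total a b with h | h
  · calc (a + b) ^ q ≤ (2 * b) ^ q := by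
          gcongr; rw [two_mul]; gcongr
      _ = 2 ^ q * b ^ q := ENNReal.mul_rpow_of_nonneg _ _ hq
      _ ≤ _ := by gcongr; exact le_add_self
  · calc (a + b) ^ q ≤ (2 * a) ^ q := by
          gcongr; rw [two_mul]; gcongr
      _ = 2 ^ q * a ^ q := ENNReal.mul_rpow_of_nonneg _ _ hq
      _ ≤ _ := by gcongr; exact le_self_add

lemma mul_le_sq_add_sq (a b : ENNReal) : a * b ≤ a ^ 2 + b ^ 2 := by
  rcases le_total a b with h | h
  · calc a * b ≤ b * b := by gcongr
      _ = b ^ 2 := by ring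
      _ ≤ _ := le_add_self
  · calc a * b ≤ a * a := by gcongr
      _ = a ^ 2 := by ring
      _ ≤ _ := le_self_add

lemma sq_rpow (a : ENNReal) (p : ℝ) : (a ^ 2) ^ (p / 2) = a ^ p := by
  rw [← ENNReal.rpow_natCast, ← ENNReal.rpow_mul]
  congr 1; push_cast; ring

lemma hk_symm (γ s t : ℝ) : hk γ s t = hk γ t s := by
  unfold hk; rw [abs_sub_comm]

lemma MM_neg (T : ℝ) (n : ℕ) (s t : ℝ) : MM T n (t - s) = MM T n (s - t) := by
  unfold MM; rw [abs_sub_comm]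

noncomputable def remd (T : ℝ) (x y : ℝ → ℝ) (s t : ℝ) : ℝ :=
  para T x y t - para T x y s - x s * (y t - y s)

/-- the double integral. -/
noncomputable def II (T : ℝ) (f : ℝ → ℝ → ENNReal) : ENNReal :=
  ∫⁻ s in Icc 0 T, ∫⁻ t in Icc 0 T, f s t

lemma II_mono {T : ℝ} {f g : ℝ → ℝ → ENNReal} (h : ∀ s ∈ Icc 0 T, ∀ t ∈ Icc 0 T, f s t ≤ g s t) :
    II T f ≤ II T g :=
  lintegral_Icc_mono fun s hs => lintegral_Icc_mono fun t ht => h s hs t ht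

lemma II_add {T : ℝ} {f g : ℝ → ℝ → ENNReal} (hf : Measurable fun q : ℝ × ℝ => f q.1 q.2) :
    II T (fun s t => f s t + g s t) = II T f + II T g := by
  unfold II
  rw [← lintegral_add_left hf.lintegral_prod_right']
  congr 1
  ext s
  exact lintegral_add_left (hf.comp (measurable_const.prodMk measurable_id)) _

lemma II_const {T : ℝ} (c : ENNReal) (hc : c ≠ ⊤) (f : ℝ → ℝ → ENNReal) :
    II T (fun s t => c * f s t) = c * II T f := by
  unfold II
  simp only [lintegral_const_mul' c _ hc]

lemma II_symm {T : ℝ} {f : ℝ → ℝ → ENNReal} (hf : Measurable fun q : ℝ × ℝ => f q.1 q.2) :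
    II T (fun s t => f t s) = II T f := by
  unfold II
  rw [lintegral_lintegral_swap]
  exact (hf.comp measurable_swap).aemeasurable

lemma sum_meas {T q γ : ℝ} {F : ℕ → ℝ → ENNReal} (hF : ∀ n, Measurable (F n)) :
    Measurable fun z : ℝ × ℝ => (∑' n, MM T n (z.2 - z.1) * F n z.1) ^ q * hk γ z.1 z.2 := by
  apply Measurable.mul _ (hk_meas γ)
  apply Measurable.pow_const
  apply Measurable.tsum
  intro n
  exact ((MM_meas T n).comp (measurable_snd.sub measurable_fst)).mul ((hF n).comp measurable_fst)

lemma II_four {T : ℝ} {F A B D : ℝ → ℝ → ENNReal} {K : ENNReal} (hK : K ≠ ⊤)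
    (mA : Measurable fun z : ℝ × ℝ => A z.1 z.2) (mB : Measurable fun z : ℝ × ℝ => B z.1 z.2)
    (mD : Measurable fun z : ℝ × ℝ => D z.1 z.2)
    (pt : ∀ s ∈ Icc 0 T, ∀ t ∈ Icc 0 T, F s t ≤ K * ((A s t + A t s) + (B s t + D t s))) :
    II T F ≤ K * ((II T A + II T A) + (II T B + II T D)) := by
  refine (II_mono pt).trans (le_of_eq ?_)
  rw [II_const K hK (fun s t => (A s t + A t s) + (B s t + D t s))]
  congr 1
  rw [II_add (f := fun s t => A s t + A t s) (g := fun s t => B s t + D t s)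
      (mA.add (mA.comp measurable_swap)),
    II_add (f := A) (g := fun s t => A t s) mA, II_symm mA,
    II_add (f := B) (g := fun s t => D t s) mB, II_symm mD]

lemma main_bound {T α p : ℝ} (hT : 0 < T) (hα0 : 0 < α) (hα : α < 1 / 2) (hαp : 1 < α * p) :
    ∃ C : ENNReal, C ≠ ⊤ ∧ ∀ x y : ℝ → ℝ, Continuous x → Continuous y →
      GG T p (α * p + 1) y ≠ ⊤ →
      II T (fun s t => ‖remd T x y s t‖ₑ ^ (p / 2) * hk (α * p + 1) s t)
        ≤ C * (GG T p (α * p + 1) x + GG T p (α * p + 1) y) := by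
  have hp2 : 2 < p := by
    by_contra h
    push Not at h
    have : α * p ≤ α * 2 := by gcongr
    linarith
  have hp : 1 < p := by linarith
  have hq : 1 < p / 2 := by linarith
  have hq0 : 0 ≤ p / 2 := by linarith
  have hγ2 : 2 < α * p + 1 := by linarith
  obtain ⟨C1, hC1, S1⟩ := schur hT (by linarith : 0 < 2 * α) (by linarith : 2 * α < 1) hq
  obtain ⟨C2, hC2, S2⟩ := schur hT hα0 (by linarith : α < 1) hp
  obtain ⟨C3, hC3, S3⟩ := EE_sum hT hp (by linarith : 0 < α * p + 1)
  have eb : 2 * α * (p / 2) = α * p := by ring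
  rw [eb] at S1
  simp only [add_sub_cancel_right] at S3
  set γ := α * p + 1 with hγ
  have h2q : (2:ENNReal) ^ (p/2) ≠ ⊤ := ENNReal.rpow_ne_top_of_nonneg hq0 (by norm_num)
  have h3q : (3000:ENNReal) ^ (p/2) ≠ ⊤ := ENNReal.rpow_ne_top_of_nonneg hq0 (by norm_num)
  set c := (2:ENNReal) ^ (p/2) with hc
  refine ⟨3000 ^ (p/2) * (c * c) * (C1 * c * C3 + C1 * c * C3 + 1 + C2 * C3), ?_, ?_⟩
  · finiteness
  intro x y hx hy hG
  have hxm := hx.measurable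
  set W : ℕ → ℝ → ENNReal := fun n s => EE T n x s ^ 2 + EE T n y s ^ 2 with hW
  have mW : ∀ n, Measurable (W n) := fun n =>
    ((EE_meas T n hx).pow_const 2).add ((EE_meas T n hy).pow_const 2)
  have mE : ∀ n, Measurable (EE T n y) := fun n => EE_meas T n hy
  set A : ℝ → ℝ → ENNReal := fun s t => (∑' n, MM T n (t - s) * W n s) ^ (p / 2) * hk γ s t with hA
  set D : ℝ → ℝ → ENNReal := fun s t => (∑' n, MM T n (t - s) * EE T n y s) ^ p * hk γ s t with hD
  have mA : Measurable fun z : ℝ × ℝ => A z.1 z.2 := sum_meas mW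
  have mD : Measurable fun z : ℝ × ℝ => D z.1 z.2 := sum_meas mE
  have mX : Measurable fun z : ℝ × ℝ => ‖x z.1 - x z.2‖ₑ ^ p * hk γ z.1 z.2 := by
    apply Measurable.mul _ (hk_meas γ)
    fun_prop
  have pt : ∀ s ∈ Icc 0 T, ∀ t ∈ Icc 0 T, ‖remd T x y s t‖ₑ ^ (p / 2) * hk γ s t ≤
      3000 ^ (p/2) * (c * c) * ((A s t + A t s) + (‖x s - x t‖ₑ ^ p * hk γ s t + D t s)) := by
    intro s hs t ht
    have h := rem_le hT hp hγ2 hx hy hG hs ht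
    set a := ∑' n, MM T n (t - s) * W n s with ha
    set b := ∑' n, MM T n (t - s) * W n t with hb
    set e := ∑' n, MM T n (t - s) * EE T n y t with he
    have h1 : ‖remd T x y s t‖ₑ ≤ 3000 * ((a + b) + (‖x t - x s‖ₑ ^ 2 + e ^ 2)) := by
      calc _ ≤ _ := h
        _ ≤ ∑' n, 3000 * ((MM T n (t - s) * W n s + MM T n (t - s) * W n t) +
              ‖x t - x s‖ₑ * (MM T n (t - s) * EE T n y t)) := by
            apply ENNReal.tsum_le_tsum
            intro n
            calc _ ≤ 3000 * MM T n (t - s) * (W n s + W n t + ‖x t - x s‖ₑ * EE T n y t) := by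
                  gcongr
                  · exact mul_le_sq_add_sq _ _
                  · exact mul_le_sq_add_sq _ _
              _ = _ := by ring
        _ = 3000 * ((a + b) + ‖x t - x s‖ₑ * e) := by
            rw [ENNReal.tsum_mul_left, ENNReal.tsum_add, ENNReal.tsum_add, ENNReal.tsum_mul_left]
        _ ≤ _ := by
            gcongr
            exact mul_le_sq_add_sq _ _
    have h2 : ‖remd T x y s t‖ₑ ^ (p/2) ≤ 3000 ^ (p/2) * (c * c) *
        ((a ^ (p/2) + b ^ (p/2)) + (‖x t - x s‖ₑ ^ p + e ^ p)) := by
      calc _ ≤ (3000 * ((a + b) + (‖x t - x s‖ₑ ^ 2 + e ^ 2))) ^ (p/2) := by gcongr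
        _ = 3000 ^ (p/2) * ((a + b) + (‖x t - x s‖ₑ ^ 2 + e ^ 2)) ^ (p/2) :=
            ENNReal.mul_rpow_of_nonneg _ _ hq0
        _ ≤ 3000 ^ (p/2) * (c * ((a + b) ^ (p/2) + (‖x t - x s‖ₑ ^ 2 + e ^ 2) ^ (p/2))) := by
            gcongr; exact add_rpow_le' _ _ hq0
        _ ≤ 3000 ^ (p/2) * (c * (c * (a ^ (p/2) + b ^ (p/2)) +
              c * ((‖x t - x s‖ₑ ^ 2) ^ (p/2) + (e ^ 2) ^ (p/2)))) := by
            gcongr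
            · exact add_rpow_le' _ _ hq0
            · exact add_rpow_le' _ _ hq0
        _ = _ := by rw [sq_rpow, sq_rpow]; ring
    have eA : A t s = b ^ (p/2) * hk γ s t := by
      simp only [hA, hb, hk_symm γ t s, MM_neg T _ t s]
    have eD : D t s = e ^ p * hk γ s t := by
      simp only [hD, he, hk_symm γ t s, MM_neg T _ t s]
    rw [eA, eD]
    calc _ ≤ 3000 ^ (p/2) * (c * c) *
        ((a ^ (p/2) + b ^ (p/2)) + (‖x t - x s‖ₑ ^ p + e ^ p)) * hk γ s t := by gcongr
      _ = _ := by
        rw [enorm_sub_rev (x t)]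
        simp only [hA]
        ring
  have iA : II T A ≤ C1 * c * C3 * (GG T p γ x + GG T p γ y) := by
    calc _ ≤ _ := S1 W mW
      _ ≤ C1 * ∑' n, ENNReal.ofReal (lam T n ^ (α * p)) * ∫⁻ s in Icc 0 T,
            c * (EE T n x s ^ p + EE T n y s ^ p) := by
          gcongr with n s
          refine (add_rpow_le' _ _ hq0).trans ?_
          rw [sq_rpow, sq_rpow]
      _ = C1 * c * ((∑' n, ENNReal.ofReal (lam T n ^ (α * p)) * ∫⁻ s in Icc 0 T, EE T n x s ^ p)
          + (∑' n, ENNReal.ofReal (lam T n ^ (α * p)) * ∫⁻ s in Icc 0 T, EE T n y s ^ p)) := by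
          rw [← ENNReal.tsum_add, mul_assoc, ← ENNReal.tsum_mul_left (a := c)]
          congr 1
          apply tsum_congr
          intro n
          rw [lintegral_const_mul' _ _ h2q, lintegral_add_left ((EE_meas T n hx).pow_const p)]
          ring
      _ ≤ C1 * c * (C3 * GG T p γ x + C3 * GG T p γ y) := by
          gcongr
          · exact S3 x hx
          · exact S3 y hy
      _ = _ := by ring
  have iD : II T D ≤ C2 * C3 * (GG T p γ x + GG T p γ y) := by
    calc _ ≤ _ := S2 (fun n => EE T n y) mE
      _ ≤ C2 * (C3 * GG T p γ y) := by gcongr; exact S3 y hy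
      _ = C2 * C3 * GG T p γ y := by ring
      _ ≤ _ := by gcongr; exact le_add_self
  have hK : (3000:ENNReal) ^ (p/2) * (c * c) ≠ ⊤ := by finiteness
  have hf := II_four hK mA (B := fun s t => ‖x s - x t‖ₑ ^ p * hk γ s t) mX mD pt
  have hX : II T (fun s t => ‖x s - x t‖ₑ ^ p * hk γ s t) = GG T p γ x := rfl
  rw [hX] at hf
  refine hf.trans ?_
  have hxx : GG T p γ x ≤ GG T p γ x + GG T p γ y := le_self_add
  clear_value A D c
  generalize GG T p γ x + GG T p γ y = G at *
  calc _ ≤ 3000 ^ (p/2) * (c * c) * ((C1 * c * C3 * G + C1 * c * C3 * G) + (G + C2 * C3 * G)) := by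
        gcongr
    _ = _ := by ring

end SobLift
namespace SobLift

lemma para_meas (T : ℝ) {x y : ℝ → ℝ} (hx : Continuous x) (hy : Continuous y) :
    Measurable (para T x y) := by
  unfold para
  apply Measurable.tsum
  intro n
  unfold dl
  exact ((av_cont T n hx).mul ((av_cont T (n+1) hy).sub (av_cont T n hy))).measurable

lemma remd_meas (T : ℝ) {x y : ℝ → ℝ} (hx : Continuous x) (hy : Continuous y) :
    Measurable fun z : ℝ × ℝ => remd T x y z.1 z.2 := by
  have h := para_meas T hx hy
  have h1 := hx.measurable
  have h2 := hy.measurable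
  unfold remd
  fun_prop

lemma dl_add (T : ℝ) (n : ℕ) {x y : ℝ → ℝ} (hx : Continuous x) (hy : Continuous y) (t : ℝ) :
    dl T n (fun u => x u + y u) t = dl T n x t + dl T n y t := by
  unfold dl; rw [av_add T _ hx hy, av_add T _ hx hy]; ring

lemma dl_smul (T : ℝ) (n : ℕ) (c : ℝ) (x : ℝ → ℝ) (t : ℝ) :
    dl T n (fun u => c * x u) t = c * dl T n x t := by
  unfold dl; rw [av_smul, av_smul]; ring

lemma para_smul (T c e : ℝ) (x y : ℝ → ℝ) (t : ℝ) :
    para T (fun u => c * x u) (fun u => e * y u) t = c * e * para T x y t := by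
  unfold para
  rw [← tsum_mul_left]
  congr 1; ext n
  rw [av_smul, dl_smul]; ring

lemma remd_smul (T c e : ℝ) (x y : ℝ → ℝ) (s t : ℝ) :
    remd T (fun u => c * x u) (fun u => e * y u) s t = c * e * remd T x y s t := by
  unfold remd
  rw [para_smul, para_smul]; ring

lemma GG_smul (T p γ c : ℝ) (hp : 0 ≤ p) (x : ℝ → ℝ) :
    GG T p γ (fun u => c * x u) = ‖c‖ₑ ^ p * GG T p γ x := by
  have h : ‖c‖ₑ ^ p ≠ ⊤ := ENNReal.rpow_ne_top_of_nonneg hp (by simp)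
  have := II_const (T := T) (‖c‖ₑ ^ p) h (fun s t => ‖x s - x t‖ₑ ^ p * hk γ s t)
  unfold GG
  unfold II at this
  rw [← this]
  congr 1; ext s; congr 1; ext t
  rw [← mul_sub, enorm_mul, ENNReal.mul_rpow_of_nonneg _ _ hp, mul_assoc]

lemma para_add_left {T p γ : ℝ} (hT : 0 < T) (hp : 1 < p) (hγ : 2 < γ)
    {x x' y : ℝ → ℝ} (hx : Continuous x) (hx' : Continuous x') (hy : Continuous y)
    (hG : GG T p γ y ≠ ⊤) {t : ℝ} (ht : t ∈ Icc 0 T) :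
    para T (fun u => x u + x' u) y t = para T x y t + para T x' y t := by
  unfold para
  rw [← (para_summable hT hp hγ hx hy hG ht).tsum_add (para_summable hT hp hγ hx' hy hG ht)]
  congr 1; ext n
  rw [av_add T n hx hx']; ring

lemma para_add_right {T p γ : ℝ} (hT : 0 < T) (hp : 1 < p) (hγ : 2 < γ)
    {x y y' : ℝ → ℝ} (hx : Continuous x) (hy : Continuous y) (hy' : Continuous y')
    (hG : GG T p γ y ≠ ⊤) (hG' : GG T p γ y' ≠ ⊤) {t : ℝ} (ht : t ∈ Icc 0 T) :
    para T x (fun u => y u + y' u) t = para T x y t + para T x y' t := by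
  unfold para
  rw [← (para_summable hT hp hγ hx hy hG ht).tsum_add (para_summable hT hp hγ hx hy' hG' ht)]
  congr 1; ext n
  rw [dl_add T n hy hy']; ring

lemma para_sub {T p γ : ℝ} (hT : 0 < T) (hp : 1 < p) (hγ : 2 < γ)
    {x x' y y' : ℝ → ℝ} (hx : Continuous x) (hx' : Continuous x') (hy : Continuous y)
    (hy' : Continuous y') (hG : GG T p γ y ≠ ⊤) (hG' : GG T p γ y' ≠ ⊤)
    (hGd : GG T p γ (fun u => y u - y' u) ≠ ⊤) {t : ℝ} (ht : t ∈ Icc 0 T) :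
    para T x y t - para T x' y' t
      = para T (fun u => x u - x' u) y t + para T x' (fun u => y u - y' u) t := by
  have h1 := para_add_left hT hp hγ (hx.sub hx') hx' hy hG ht
  have h2 := para_add_right hT hp hγ hx' (hy.sub hy') hy' hGd hG' ht
  simp only [Pi.sub_apply, sub_add_cancel] at h1 h2
  have e1 : para T x y t = para T (fun u => x u - x' u) y t + para T x' y t := h1
  have e2 : para T x' y t = para T x' (fun u => y u - y' u) t + para T x' y' t := h2
  rw [e1, e2]; ring

/-- product of the increments -/
noncomputable def prd (x y : ℝ → ℝ) (s t : ℝ) : ℝ := (x t - x s) * (y t - y s)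

lemma II_add_le {T : ℝ} {f g h : ℝ → ℝ → ENNReal} {c : ENNReal} (hc : c ≠ ⊤)
    (hf : Measurable fun q : ℝ × ℝ => f q.1 q.2)
    (hh : ∀ s ∈ Icc 0 T, ∀ t ∈ Icc 0 T, h s t ≤ c * (f s t + g s t)) :
    II T h ≤ c * (II T f + II T g) := by
  refine (II_mono hh).trans (le_of_eq ?_)
  rw [II_const c hc (fun s t => f s t + g s t), II_add (f := f) (g := g) hf]

lemma prd_bound {T p γ : ℝ} (hp : 0 ≤ p) (x y : ℝ → ℝ) (hx : Continuous x) :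
    II T (fun s t => ‖prd x y s t‖ₑ ^ (p / 2) * hk γ s t)
        ≤ 2 ^ (p/2) * (GG T p γ x + GG T p γ y) := by
  have hxm := hx.measurable
  have hq0 : 0 ≤ p / 2 := by linarith
  apply II_add_le (f := fun s t => ‖x s - x t‖ₑ ^ p * hk γ s t)
    (g := fun s t => ‖y s - y t‖ₑ ^ p * hk γ s t)
    (ENNReal.rpow_ne_top_of_nonneg hq0 (by norm_num))
  · apply Measurable.mul _ (hk_meas γ)
    fun_prop
  · intro s _ t _
    calc _ ≤ ((‖x s - x t‖ₑ) ^ 2 + (‖y s - y t‖ₑ)^2) ^ (p/2) * hk γ s t := by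
          gcongr
          unfold prd
          rw [enorm_mul, enorm_sub_rev (x t), enorm_sub_rev (y t)]
          exact mul_le_sq_add_sq _ _
      _ ≤ (2 ^ (p/2) * (‖x s - x t‖ₑ ^ p + ‖y s - y t‖ₑ ^ p)) * hk γ s t := by
          gcongr
          refine (add_rpow_le' _ _ hq0).trans ?_
          rw [sq_rpow, sq_rpow]
      _ = _ := by ring

/-- A pairing satisfying the a priori bound and rescaling. -/
structure Pairing (T p γ : ℝ) (B : (ℝ → ℝ) → (ℝ → ℝ) → ℝ → ℝ → ℝ) : Prop where
  smul : ∀ (c e : ℝ) (x y : ℝ → ℝ) (s t : ℝ),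
    B (fun u => c * x u) (fun u => e * y u) s t = c * e * B x y s t
  meas : ∀ x y : ℝ → ℝ, Continuous x → Continuous y → Measurable fun z : ℝ × ℝ => B x y z.1 z.2
  sub : ∀ x x' y y' : ℝ → ℝ, Continuous x → Continuous x' → Continuous y → Continuous y' →
    GG T p γ y ≠ ⊤ → GG T p γ y' ≠ ⊤ → GG T p γ (fun u => y u - y' u) ≠ ⊤ →
    ∀ s ∈ Icc 0 T, ∀ t ∈ Icc 0 T,
    B x y s t - B x' y' s t = B (fun u => x u - x' u) y s t + B x' (fun u => y u - y' u) s t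
  bound : ∃ C : ENNReal, C ≠ ⊤ ∧ ∀ x y : ℝ → ℝ, Continuous x → Continuous y →
      GG T p γ y ≠ ⊤ → II T (fun s t => ‖B x y s t‖ₑ ^ (p / 2) * hk γ s t)
        ≤ C * (GG T p γ x + GG T p γ y)

lemma pairing_prd {T p γ : ℝ} (hp : 0 ≤ p) : Pairing T p γ prd where
  smul := by intro c e x y s t; unfold prd; ring
  meas := by
    intro x y hx hy
    have h1 := hx.measurable
    have h2 := hy.measurable
    unfold prd; fun_prop
  sub := by intros; unfold prd; ring
  bound := ⟨2 ^ (p/2), ENNReal.rpow_ne_top_of_nonneg (by linarith) (by norm_num),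
    fun x y hx _ _ => prd_bound hp x y hx⟩

lemma pairing_remd {T α p : ℝ} (hT : 0 < T) (hα0 : 0 < α) (hα : α < 1 / 2) (hp : 1 < p)
    (hαp : 1 < α * p) :
    Pairing T p (α * p + 1) (remd T) where
  smul := remd_smul T
  meas := fun x y hx hy => remd_meas T hx hy
  sub := by
    intro x x' y y' hx hx' hy hy' h1 h2 h3 s hs t ht
    have e1 := para_sub hT hp (by linarith) hx hx' hy hy' h1 h2 h3 hs
    have e2 := para_sub hT hp (by linarith) hx hx' hy hy' h1 h2 h3 ht
    unfold remd
    linear_combination e2 - e1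
  bound := main_bound hT hα0 hα hαp

lemma Pairing.diag {T p γ : ℝ} (hp : 0 < p) {B} (hB : Pairing T p γ B) (R : ℝ) :
    ∃ C : ENNReal, C ≠ ⊤ ∧ ∀ x y : ℝ → ℝ, Continuous x → Continuous y → ∀ δ : ℝ, 0 < δ →
      (GG T p γ x ≤ ENNReal.ofReal δ ^ p ∧ GG T p γ y ≤ ENNReal.ofReal R ^ p ∨
       GG T p γ y ≤ ENNReal.ofReal δ ^ p ∧ GG T p γ x ≤ ENNReal.ofReal R ^ p) →
      II T (fun s t => ‖B x y s t‖ₑ ^ (p / 2) * hk γ s t) ≤ C * ENNReal.ofReal δ ^ (p/2) := by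
  obtain ⟨C, hC, h⟩ := hB.bound
  have hRt : ENNReal.ofReal R ^ p ≠ ⊤ := ENNReal.rpow_ne_top_of_nonneg hp.le (by simp)
  refine ⟨C * (1 + ENNReal.ofReal R ^ p), by finiteness, ?_⟩
  intro x y hx hy δ hδ hh
  have hδt : ENNReal.ofReal δ ^ p ≠ ⊤ := ENNReal.rpow_ne_top_of_nonneg hp.le (by simp)
  -- scaling
  set c : ℝ := δ ^ (-(1/2) : ℝ) with hc
  have hc0 : 0 < c := Real.rpow_pos_of_pos hδ _
  set D := ENNReal.ofReal δ with hD
  have hD0 : D ≠ 0 := by simp [hD, hδ]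
  have hDt : D ≠ ⊤ := by simp [hD]
  have ec : ‖c‖ₑ = D ^ (-(1/2) : ℝ) := by
    rw [Real.enorm_of_nonneg hc0.le, hc, hD, ENNReal.ofReal_rpow_of_pos hδ]
  have eci : ‖c⁻¹‖ₑ = D ^ (1/2 : ℝ) := by
    rw [Real.enorm_of_nonneg (inv_pos.2 hc0).le, hc, hD, ENNReal.ofReal_rpow_of_pos hδ,
      ← Real.rpow_neg hδ.le, neg_neg]
  have k1 : ∀ a, a ≤ D ^ p → ‖c‖ₑ ^ p * a ≤ D ^ (p/2) := by
    intro a ha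
    calc _ ≤ ‖c‖ₑ ^ p * D ^ p := by gcongr
      _ = _ := by
        rw [ec, ← ENNReal.rpow_mul, ← ENNReal.rpow_add _ _ hD0 hDt]
        congr 1; ring
  have k2 : ∀ a, a ≤ ENNReal.ofReal R ^ p → ‖c⁻¹‖ₑ ^ p * a ≤ D ^ (p/2) * ENNReal.ofReal R ^ p := by
    intro a ha
    calc _ ≤ ‖c⁻¹‖ₑ ^ p * ENNReal.ofReal R ^ p := by gcongr
      _ = _ := by
        rw [eci, ← ENNReal.rpow_mul]
        congr 2; ring
  have hcc : c * c⁻¹ = 1 := mul_inv_cancel₀ hc0.ne'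
  have hcc' : c⁻¹ * c = 1 := inv_mul_cancel₀ hc0.ne'
  rcases hh with ⟨h1, h2⟩ | ⟨h1, h2⟩
  · have hy0 := GG_smul T p γ c⁻¹ hp.le y
    have hx0 := GG_smul T p γ c hp.le x
    have := h (fun u => c * x u) (fun u => c⁻¹ * y u) (by fun_prop) (by fun_prop) (by
      rw [hy0]; exact ne_top_of_le_ne_top (by finiteness) (k2 _ h2))
    simp only [hB.smul, hcc, one_mul] at this
    refine this.trans ?_
    rw [hx0, hy0, mul_assoc]
    gcongr
    calc _ ≤ D ^ (p/2) + D ^ (p/2) * ENNReal.ofReal R ^ p := add_le_add (k1 _ h1) (k2 _ h2)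
      _ = _ := by ring
  · have hy0 := GG_smul T p γ c hp.le y
    have hx0 := GG_smul T p γ c⁻¹ hp.le x
    have := h (fun u => c⁻¹ * x u) (fun u => c * y u) (by fun_prop) (by fun_prop) (by
      rw [hy0]; exact ne_top_of_le_ne_top (by finiteness) (k1 _ h1))
    simp only [hB.smul, hcc', one_mul] at this
    refine this.trans ?_
    rw [hx0, hy0, mul_assoc]
    gcongr
    calc _ ≤ D ^ (p/2) * ENNReal.ofReal R ^ p + D ^ (p/2) := add_le_add (k2 _ h2) (k1 _ h1)
      _ = _ := by ring

lemma Pairing.diff {T p γ : ℝ} (hp : 0 < p) {B} (hB : Pairing T p γ B) (R : ℝ) :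
    ∃ C : ENNReal, C ≠ ⊤ ∧ ∀ x x' y y' : ℝ → ℝ, Continuous x → Continuous x' → Continuous y →
      Continuous y' → ∀ δ : ℝ, 0 < δ →
      GG T p γ (fun u => x u - x' u) ≤ ENNReal.ofReal δ ^ p →
      GG T p γ (fun u => y u - y' u) ≤ ENNReal.ofReal δ ^ p →
      GG T p γ x' ≤ ENNReal.ofReal R ^ p → GG T p γ y ≤ ENNReal.ofReal R ^ p →
      GG T p γ y' ≤ ENNReal.ofReal R ^ p →
      II T (fun s t => ‖B x y s t - B x' y' s t‖ₑ ^ (p / 2) * hk γ s t)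
        ≤ C * ENNReal.ofReal δ ^ (p/2) := by
  obtain ⟨C, hC, h⟩ := hB.diag hp R
  have hq0 : 0 ≤ p / 2 := by linarith
  have h2q : (2:ENNReal) ^ (p/2) ≠ ⊤ := ENNReal.rpow_ne_top_of_nonneg hq0 (by norm_num)
  refine ⟨2 ^ (p/2) * (C + C), by finiteness, ?_⟩
  intro x x' y y' hx hx' hy hy' δ hδ h1 h2 h3 h4 h5
  have hfin : ∀ r : ℝ, ENNReal.ofReal r ^ p ≠ ⊤ :=
    fun r => ENNReal.rpow_ne_top_of_nonneg hp.le (by simp)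
  have a1 := h (fun u => x u - x' u) y (by fun_prop) hy δ hδ (Or.inl ⟨h1, h4⟩)
  have a2 := h x' (fun u => y u - y' u) hx' (by fun_prop) δ hδ (Or.inr ⟨h2, h3⟩)
  have mm := hB.meas (fun u => x u - x' u) y (by fun_prop) hy
  have := II_add_le (T := T) (f := fun s t => ‖B (fun u => x u - x' u) y s t‖ₑ ^ (p / 2) * hk γ s t)
    (g := fun s t => ‖B x' (fun u => y u - y' u) s t‖ₑ ^ (p / 2) * hk γ s t)
    (h := fun s t => ‖B x y s t - B x' y' s t‖ₑ ^ (p / 2) * hk γ s t) h2q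
    (((mm.enorm).pow_const _).mul (hk_meas γ)) (by
      intro s hs t ht
      rw [hB.sub x x' y y' hx hx' hy hy' (ne_top_of_le_ne_top (hfin R) h4)
        (ne_top_of_le_ne_top (hfin R) h5) (ne_top_of_le_ne_top (hfin δ) h2) s hs t ht]
      calc _ ≤ (‖B (fun u => x u - x' u) y s t‖ₑ + ‖B x' (fun u => y u - y' u) s t‖ₑ) ^ (p/2)
              * hk γ s t := by gcongr; exact enorm_add_le _ _
        _ ≤ (2 ^ (p/2) * (‖B (fun u => x u - x' u) y s t‖ₑ ^ (p/2)
              + ‖B x' (fun u => y u - y' u) s t‖ₑ ^ (p/2))) * hk γ s t := by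
            gcongr; exact add_rpow_le' _ _ hq0
        _ = _ := by ring)
  refine this.trans ?_
  calc _ ≤ 2 ^ (p/2) * (C * ENNReal.ofReal δ ^ (p/2) + C * ENNReal.ofReal δ ^ (p/2)) := by gcongr
    _ = _ := by ring

end SobLift
namespace SobLift

noncomputable def bb {d : ℕ} (T : ℝ) (X : ℝ → EuclideanSpace ℝ (Fin d)) (t : ℝ) :
    Matrix (Fin d) (Fin d) ℝ :=
  Matrix.of fun i j =>
    if i < j then para T (fun u => X u i) (fun u => X u j) t
    else if i = j then X t i * X t j / 2
    else X t i * X t j - para T (fun u => X u j) (fun u => X u i) t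

lemma bb_symm {d : ℕ} (T : ℝ) (X : ℝ → EuclideanSpace ℝ (Fin d)) (t : ℝ) (i j : Fin d) :
    bb T X t i j + bb T X t j i = X t i * X t j := by
  rcases lt_trichotomy i j with h | h | h
  · simp only [bb, Matrix.of_apply, if_pos h, if_neg h.not_gt, if_neg h.ne']; ring
  · subst h; simp [bb]
  · simp only [bb, Matrix.of_apply, if_pos h, if_neg h.not_gt, if_neg h.ne']; ring

lemma incr_le {d : ℕ} (T : ℝ) (X X' : ℝ → EuclideanSpace ℝ (Fin d)) (s t : ℝ) (i j : Fin d) :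
    ‖secondIncr d X (bb T X) s t i j - secondIncr d X' (bb T X') s t i j‖ₑ ≤
      ‖prd (fun u => X u i) (fun u => X u j) s t - prd (fun u => X' u i) (fun u => X' u j) s t‖ₑ +
      (‖remd T (fun u => X u i) (fun u => X u j) s t
          - remd T (fun u => X' u i) (fun u => X' u j) s t‖ₑ +
       ‖remd T (fun u => X u j) (fun u => X u i) s t
          - remd T (fun u => X' u j) (fun u => X' u i) s t‖ₑ) := by
  rcases lt_trichotomy i j with h | h | h
  · refine le_trans ?_ le_add_self
    refine le_trans ?_ le_self_add
    simp only [secondIncr, bb, Matrix.of_apply, if_pos h, remd]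
    exact le_rfl
  · subst h
    refine le_trans ?_ le_self_add
    have e : secondIncr d X (bb T X) s t i i - secondIncr d X' (bb T X') s t i i
      = (1/2) * (prd (fun u => X u i) (fun u => X u i) s t
          - prd (fun u => X' u i) (fun u => X' u i) s t) := by
      simp only [secondIncr, bb, Matrix.of_apply, lt_irrefl, if_false, if_true, prd]
      ring
    rw [e, enorm_mul]
    refine mul_le_of_le_one_left (zero_le) ?_
    rw [Real.enorm_of_nonneg (by norm_num)]
    exact ENNReal.ofReal_le_one.2 (by norm_num)
  · have e : secondIncr d X (bb T X) s t i j - secondIncr d X' (bb T X') s t i j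
      = (prd (fun u => X u i) (fun u => X u j) s t - prd (fun u => X' u i) (fun u => X' u j) s t)
        - (remd T (fun u => X u j) (fun u => X u i) s t
          - remd T (fun u => X' u j) (fun u => X' u i) s t) := by
      simp only [secondIncr, bb, Matrix.of_apply, if_neg h.not_gt, if_neg h.ne', prd, remd]
      ring
    rw [e]
    refine (enorm_sub_le_add _ _).trans ?_
    gcongr
    exact le_add_self

lemma II_sum {ι : Type*} (I : Finset ι) {T : ℝ} {f : ι → ℝ → ℝ → ENNReal}
    (hf : ∀ i, Measurable fun q : ℝ × ℝ => f i q.1 q.2) :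
    II T (fun s t => ∑ i ∈ I, f i s t) = ∑ i ∈ I, II T (f i) := by
  unfold II
  rw [← lintegral_finsetSum I (fun i _ => (hf i).lintegral_prod_right')]
  congr 1
  ext s
  exact lintegral_finsetSum I (fun i _ => (hf i).comp (measurable_const.prodMk measurable_id))

/-- vector Gagliardo integral -/
noncomputable def VG {d : ℕ} (T p γ : ℝ) (X : ℝ → EuclideanSpace ℝ (Fin d)) : ENNReal :=
  II T (fun s t => ‖X s - X t‖ₑ ^ p * hk γ s t)

lemma GG_le_VG {d : ℕ} {T p γ : ℝ} (hp : 0 ≤ p) (X : ℝ → EuclideanSpace ℝ (Fin d)) (i : Fin d) :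
    GG T p γ (fun u => X u i) ≤ VG T p γ X := by
  apply II_mono (f := fun s t => ‖X s i - X t i‖ₑ ^ p * hk γ s t)
  intro s _ t _
  gcongr
  rw [← ofReal_norm, ← ofReal_norm]
  exact ENNReal.ofReal_le_ofReal (PiLp.norm_apply_le (X s - X t) i)

lemma sqrt_le {d : ℕ} (D : Matrix (Fin d) (Fin d) ℝ) :
    ENNReal.ofReal (Real.sqrt (∑ i, ∑ j, D i j ^ 2)) ≤ ∑ k : Fin d × Fin d, ‖D k.1 k.2‖ₑ := by
  have h : Real.sqrt (∑ i, ∑ j, D i j ^ 2) ≤ ∑ k : Fin d × Fin d, |D k.1 k.2| := by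
    rw [Real.sqrt_le_left (Finset.sum_nonneg fun k _ => abs_nonneg _), ← Fintype.sum_prod_type']
    simp only [← sq_abs (D _ _)]
    exact Finset.sum_sq_le_sq_sum_of_nonneg (fun k _ => abs_nonneg _)
  refine (ENNReal.ofReal_le_ofReal h).trans (le_of_eq ?_)
  rw [ENNReal.ofReal_sum_of_nonneg (fun k _ => abs_nonneg _)]
  congr 1; ext k
  rw [← Real.norm_eq_abs, ofReal_norm]

lemma core {d : ℕ} {T α p : ℝ} (hT : 0 < T) (hα0 : 0 < α) (hα : α < 1 / 2) (hp : 2 < p)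
    (hαp : 1 < α * p) (R : ℝ) :
    ∃ C : ENNReal, C ≠ ⊤ ∧ ∀ X X' : ℝ → EuclideanSpace ℝ (Fin d), Continuous X → Continuous X' →
      ∀ δ : ℝ, 0 < δ →
      VG T p (α * p + 1) (fun u => X u - X' u) ≤ ENNReal.ofReal δ ^ p →
      VG T p (α * p + 1) X ≤ ENNReal.ofReal R ^ p →
      VG T p (α * p + 1) X' ≤ ENNReal.ofReal R ^ p →
      II T (fun s t => ENNReal.ofReal (Real.sqrt (∑ i, ∑ j,
          (secondIncr d X (bb T X) s t i j - secondIncr d X' (bb T X') s t i j) ^ 2)) ^ (p / 2)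
            * hk (α * p + 1) s t)
        ≤ C * ENNReal.ofReal δ ^ (p/2) := by
  have hp0 : 0 < p := by linarith
  have hq0 : 0 ≤ p / 2 := by linarith
  have hP : Pairing T p (α * p + 1) prd := pairing_prd hp0.le
  have hM := pairing_remd hT hα0 hα (by linarith) hαp
  set γ := α * p + 1 with hγ
  obtain ⟨C1, hC1, b1⟩ := hP.diff hp0 R
  obtain ⟨C2, hC2, b2⟩ := hM.diff hp0 R
  have h2q : (2:ENNReal) ^ (p/2) ≠ ⊤ := ENNReal.rpow_ne_top_of_nonneg hq0 (by norm_num)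
  set c := (2:ENNReal) ^ (p/2) with hc
  set N := ((Finset.univ : Finset (Fin d × Fin d)).card : ENNReal) with hN
  have hNt : N ^ (p / 2 - 1) ≠ ⊤ := ENNReal.rpow_ne_top_of_nonneg (by linarith) (ENNReal.natCast_ne_top _)
  have hNt' : N ≠ ⊤ := ENNReal.natCast_ne_top _
  refine ⟨N ^ (p/2 - 1) * (c + c * c) * (N * (C1 + (C2 + C2))), by finiteness, ?_⟩
  intro X X' hX hX' δ hδ h1 h2 h3
  have cX : ∀ i, Continuous fun u => X u i := fun i => by fun_prop
  have cX' : ∀ i, Continuous fun u => X' u i := fun i => by fun_prop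
  have g1 : ∀ i, GG T p γ (fun u => X u i - X' u i) ≤ ENNReal.ofReal δ ^ p :=
    fun i => (GG_le_VG hp0.le (fun u => X u - X' u) i).trans h1
  have g2 : ∀ i, GG T p γ (fun u => X u i) ≤ ENNReal.ofReal R ^ p :=
    fun i => (GG_le_VG hp0.le X i).trans h2
  have g3 : ∀ i, GG T p γ (fun u => X' u i) ≤ ENNReal.ofReal R ^ p :=
    fun i => (GG_le_VG hp0.le X' i).trans h3
  set P : Fin d × Fin d → ℝ → ℝ → ENNReal := fun k s t =>
    ‖prd (fun u => X u k.1) (fun u => X u k.2) s t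
      - prd (fun u => X' u k.1) (fun u => X' u k.2) s t‖ₑ with hPd
  set Q : Fin d × Fin d → ℝ → ℝ → ENNReal := fun k s t =>
    ‖remd T (fun u => X u k.1) (fun u => X u k.2) s t
      - remd T (fun u => X' u k.1) (fun u => X' u k.2) s t‖ₑ with hQd
  have mP : ∀ k, Measurable fun z : ℝ × ℝ => P k z.1 z.2 ^ (p/2) * hk γ z.1 z.2 := fun k =>
    ((((hP.meas _ _ (cX k.1) (cX k.2)).sub (hP.meas _ _ (cX' k.1) (cX' k.2))).enorm).pow_const
      _).mul (hk_meas γ)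
  have mQ : ∀ k, Measurable fun z : ℝ × ℝ => Q k z.1 z.2 ^ (p/2) * hk γ z.1 z.2 := fun k =>
    ((((hM.meas _ _ (cX k.1) (cX k.2)).sub (hM.meas _ _ (cX' k.1) (cX' k.2))).enorm).pow_const
      _).mul (hk_meas γ)
  have iP : ∀ k, II T (fun s t => P k s t ^ (p/2) * hk γ s t) ≤ C1 * ENNReal.ofReal δ ^ (p/2) :=
    fun k => b1 _ _ _ _ (cX k.1) (cX' k.1) (cX k.2) (cX' k.2) δ hδ (g1 _) (g1 _) (g3 _) (g2 _) (g3 _)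
  have iQ : ∀ k, II T (fun s t => Q k s t ^ (p/2) * hk γ s t) ≤ C2 * ENNReal.ofReal δ ^ (p/2) :=
    fun k => b2 _ _ _ _ (cX k.1) (cX' k.1) (cX k.2) (cX' k.2) δ hδ (g1 _) (g1 _) (g3 _) (g2 _) (g3 _)
  set U : Fin d × Fin d → ℝ → ℝ → ENNReal := fun k s t =>
    P k s t ^ (p/2) * hk γ s t + (Q k s t ^ (p/2) * hk γ s t + Q k.swap s t ^ (p/2) * hk γ s t)
    with hU
  have mU : ∀ k, Measurable fun z : ℝ × ℝ => U k z.1 z.2 := fun k =>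
    (mP k).add ((mQ k).add (mQ k.swap))
  have iU : ∀ k, II T (U k) ≤ (C1 + (C2 + C2)) * ENNReal.ofReal δ ^ (p/2) := by
    intro k
    rw [hU]
    rw [II_add (f := fun s t => P k s t ^ (p/2) * hk γ s t)
        (g := fun s t => Q k s t ^ (p/2) * hk γ s t + Q k.swap s t ^ (p/2) * hk γ s t) (mP k),
      II_add (f := fun s t => Q k s t ^ (p/2) * hk γ s t)
        (g := fun s t => Q k.swap s t ^ (p/2) * hk γ s t) (mQ k), add_mul, add_mul]
    exact add_le_add (iP k) (add_le_add (iQ k) (iQ k.swap))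
  have pt : ∀ s ∈ Icc 0 T, ∀ t ∈ Icc 0 T, ENNReal.ofReal (Real.sqrt (∑ i, ∑ j,
          (secondIncr d X (bb T X) s t i j - secondIncr d X' (bb T X') s t i j) ^ 2)) ^ (p / 2)
            * hk γ s t ≤ (N ^ (p/2 - 1) * (c + c * c)) * ∑ k : Fin d × Fin d, U k s t := by
    intro s _ t _
    have k1 : ∀ k : Fin d × Fin d, ‖(secondIncr d X (bb T X) s t - secondIncr d X' (bb T X') s t)
        k.1 k.2‖ₑ ^ (p/2) ≤ (c + c * c) * (P k s t ^ (p/2) +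
          (Q k s t ^ (p/2) + Q k.swap s t ^ (p/2))) := by
      intro k
      calc _ ≤ (P k s t + (Q k s t + Q k.swap s t)) ^ (p/2) := by
            gcongr
            exact incr_le T X X' s t k.1 k.2
        _ ≤ c * (P k s t ^ (p/2) + (Q k s t + Q k.swap s t) ^ (p/2)) := add_rpow_le' _ _ hq0
        _ ≤ c * (P k s t ^ (p/2) + c * (Q k s t ^ (p/2) + Q k.swap s t ^ (p/2))) := by
            gcongr; exact add_rpow_le' _ _ hq0
        _ = c * P k s t ^ (p/2) + c * c * (Q k s t ^ (p/2) + Q k.swap s t ^ (p/2)) := by ring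
        _ ≤ (c + c * c) * P k s t ^ (p/2)
            + (c + c * c) * (Q k s t ^ (p/2) + Q k.swap s t ^ (p/2)) := by
            gcongr
            · exact le_self_add
            · exact le_add_self
        _ = _ := by ring
    have k0 := sqrt_le (secondIncr d X (bb T X) s t - secondIncr d X' (bb T X') s t)
    calc _ ≤ (∑ k : Fin d × Fin d, ‖(secondIncr d X (bb T X) s t - secondIncr d X' (bb T X') s t)
              k.1 k.2‖ₑ) ^ (p/2) * hk γ s t := by
          gcongr
          exact k0
      _ ≤ (N ^ (p/2 - 1) * ∑ k : Fin d × Fin d, ‖(secondIncr d X (bb T X) s t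
            - secondIncr d X' (bb T X') s t) k.1 k.2‖ₑ ^ (p/2)) * hk γ s t := by
          gcongr
          exact ENNReal.rpow_sum_le_const_mul_sum_rpow _ _ (by linarith)
      _ ≤ (N ^ (p/2 - 1) * ∑ k : Fin d × Fin d, (c + c * c) * (P k s t ^ (p/2) +
          (Q k s t ^ (p/2) + Q k.swap s t ^ (p/2)))) * hk γ s t := by
          gcongr with k
          exact k1 k
      _ = _ := by
          rw [← Finset.mul_sum]
          have : ∑ k, U k s t = (∑ k, (P k s t ^ (p/2) +
              (Q k s t ^ (p/2) + Q k.swap s t ^ (p/2)))) * hk γ s t := by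
            rw [Finset.sum_mul]
            apply Finset.sum_congr rfl
            intro k _
            simp only [hU]; ring
          rw [this]; ring
  refine (II_mono pt).trans ?_
  rw [II_const _ (by finiteness) (fun s t => ∑ k, U k s t), II_sum Finset.univ mU]
  rw [mul_assoc (N ^ (p/2 - 1) * (c + c * c))]
  gcongr
  calc _ ≤ ∑ k : Fin d × Fin d, (C1 + (C2 + C2)) * ENNReal.ofReal δ ^ (p/2) :=
        Finset.sum_le_sum fun k _ => iU k
    _ = _ := by rw [Finset.sum_const, nsmul_eq_mul, mul_assoc]

end SobLift
namespace SobLift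

def ext {d : ℕ} (T : ℝ) (X : ℝ → EuclideanSpace ℝ (Fin d)) (t : ℝ) : EuclideanSpace ℝ (Fin d) :=
  X (max 0 (min T t))

lemma ext_cont {d : ℕ} {T : ℝ} (hT : 0 < T) {X : ℝ → EuclideanSpace ℝ (Fin d)}
    (hX : ContinuousOn X (Icc 0 T)) : Continuous (ext T X) := by
  apply hX.comp_continuous (by fun_prop)
  intro t
  exact ⟨le_max_left _ _, max_le hT.le (min_le_left _ _)⟩

lemma ext_eq {d : ℕ} {T : ℝ} (X : ℝ → EuclideanSpace ℝ (Fin d)) {t : ℝ} (ht : t ∈ Icc 0 T) :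
    ext T X t = X t := by
  unfold ext
  rw [min_eq_right ht.2, max_eq_right ht.1]

lemma ofReal_div {a b q γ : ℝ} (ha : 0 ≤ a) (hb : 0 ≤ b) (hq : 0 ≤ q) :
    ENNReal.ofReal (a ^ q / b ^ γ) = ENNReal.ofReal a ^ q * ENNReal.ofReal (b ^ (-γ)) := by
  rw [Real.rpow_neg hb, div_eq_mul_inv, ENNReal.ofReal_mul (Real.rpow_nonneg ha _),
    ENNReal.ofReal_rpow_of_nonneg ha hq]

lemma II_congr {T : ℝ} {f g : ℝ → ℝ → ENNReal} (h : ∀ s ∈ Icc 0 T, ∀ t ∈ Icc 0 T, f s t = g s t) :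
    II T f = II T g :=
  le_antisymm (II_mono fun s hs t ht => (h s hs t ht).le)
    (II_mono fun s hs t ht => (h s hs t ht).ge)

lemma VG_eq {d : ℕ} {T p γ : ℝ} (hp : 0 ≤ p) (X : ℝ → EuclideanSpace ℝ (Fin d)) :
    VG T p γ X = II T (fun u v => ENNReal.ofReal (‖X u - X v‖ ^ p / |v - u| ^ γ)) := by
  unfold VG
  apply II_congr
  intro s _ t _
  rw [ofReal_div (norm_nonneg _) (abs_nonneg _) hp, ofReal_norm]
  rfl

lemma VG_ext {d : ℕ} {T p γ : ℝ} (X : ℝ → EuclideanSpace ℝ (Fin d)) :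
    VG T p γ (ext T X) = VG T p γ X := by
  unfold VG
  apply II_congr
  intro s hs t ht
  rw [ext_eq X hs, ext_eq X ht]

lemma VG_sub {d : ℕ} {T p γ : ℝ} (hp : 0 ≤ p) {X X' : ℝ → EuclideanSpace ℝ (Fin d)}
    (hX : Continuous X) :
    VG T p γ (fun u => X u - X' u) ≤ 2 ^ p * (VG T p γ X + VG T p γ X') := by
  have hm := hX.measurable
  apply II_add_le (ENNReal.rpow_ne_top_of_nonneg hp (by norm_num))
  · apply Measurable.mul _ (hk_meas γ)
    fun_prop
  · intro s _ t _
    calc _ ≤ (‖X s - X t‖ₑ + ‖X' s - X' t‖ₑ) ^ p * hk γ s t := by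
          gcongr
          have : X s - X' s - (X t - X' t) = (X s - X t) - (X' s - X' t) := by abel
          rw [this]
          exact enorm_sub_le
      _ ≤ (2 ^ p * (‖X s - X t‖ₑ ^ p + ‖X' s - X' t‖ₑ ^ p)) * hk γ s t := by
          gcongr
          exact add_rpow_le' _ _ hp
      _ = _ := by ring

lemma ofReal_dint_le {T : ℝ} (f : ℝ → ℝ → ℝ) (hf : ∀ s t, 0 ≤ f s t) :
    ENNReal.ofReal (∫ s in Icc 0 T, ∫ t in Icc 0 T, f s t)
      ≤ II T (fun s t => ENNReal.ofReal (f s t)) := by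
  refine (Real.ofReal_le_enorm _).trans ?_
  refine (enorm_integral_le_lintegral_enorm _).trans ?_
  unfold II
  apply lintegral_mono
  intro s
  refine (enorm_integral_le_lintegral_enorm _).trans (le_of_eq ?_)
  congr 1; ext t
  exact Real.enorm_of_nonneg (hf s t)

lemma II_eq_ofReal {T : ℝ} (f : ℝ → ℝ → ℝ) (hf : ∀ s t, 0 ≤ f s t)
    (hm : Measurable fun z : ℝ × ℝ => f z.1 z.2)
    (hfin : II T (fun s t => ENNReal.ofReal (f s t)) ≠ ⊤) :
    II T (fun s t => ENNReal.ofReal (f s t))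
      = ENNReal.ofReal (∫ s in Icc 0 T, ∫ t in Icc 0 T, f s t) := by
  set μ := (volume : Measure ℝ).restrict (Icc 0 T) with hμ
  have e1 : ∫⁻ z, ENNReal.ofReal (f z.1 z.2) ∂(μ.prod μ) =
      II T (fun s t => ENNReal.ofReal (f s t)) := by
    rw [lintegral_prod _ (hm.ennreal_ofReal.aemeasurable)]
    rfl
  have hnn : 0 ≤ᵐ[μ.prod μ] fun z : ℝ × ℝ => f z.1 z.2 :=
    Filter.Eventually.of_forall fun z => hf z.1 z.2
  have hi : Integrable (fun z : ℝ × ℝ => f z.1 z.2) (μ.prod μ) := by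
    refine ⟨hm.aestronglyMeasurable, ?_⟩
    rw [hasFiniteIntegral_iff_ofReal hnn, e1]
    exact hfin.lt_top
  rw [integral_integral (f := f) hi, integral_eq_lintegral_of_nonneg_ae hnn
    hm.aestronglyMeasurable, e1,
    ENNReal.ofReal_toReal hfin]

lemma dint_congr {T : ℝ} {f g : ℝ → ℝ → ℝ} (h : ∀ s ∈ Icc 0 T, ∀ t ∈ Icc 0 T, f s t = g s t) :
    ∫ s in Icc 0 T, ∫ t in Icc 0 T, f s t = ∫ s in Icc 0 T, ∫ t in Icc 0 T, g s t :=
  setIntegral_congr_fun measurableSet_Icc fun s hs =>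
    setIntegral_congr_fun measurableSet_Icc fun t ht => h s hs t ht

lemma dint_nonneg {T : ℝ} {f : ℝ → ℝ → ℝ} (hf : ∀ s t, 0 ≤ f s t) :
    0 ≤ ∫ s in Icc 0 T, ∫ t in Icc 0 T, f s t :=
  integral_nonneg fun s => integral_nonneg fun t => hf s t

lemma gag_nonneg {d : ℕ} (p γ : ℝ) (X : ℝ → EuclideanSpace ℝ (Fin d)) (u v : ℝ) :
    0 ≤ ‖X u - X v‖ ^ p / |v - u| ^ γ := by positivity

lemma gag_le_norm {d : ℕ} (T α p : ℝ) (X : ℝ → EuclideanSpace ℝ (Fin d)) :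
    (∫ u in Icc (0:ℝ) T, ∫ v in Icc (0:ℝ) T,
      ‖X u - X v‖ ^ p / |v - u| ^ (α * p + 1)) ^ (1/p) ≤ pathSobNorm d T α p X := by
  unfold pathSobNorm
  refine le_add_of_nonneg_right (Real.rpow_nonneg (integral_nonneg fun u => ?_) _)
  positivity

lemma norm_nonneg' {d : ℕ} (T α p : ℝ) (X : ℝ → EuclideanSpace ℝ (Fin d)) :
    0 ≤ pathSobNorm d T α p X :=
  (Real.rpow_nonneg (dint_nonneg (gag_nonneg p _ X)) _).trans (gag_le_norm T α p X)

lemma VG_le {d : ℕ} {T α p : ℝ} (hT : 0 < T) (hp : 0 < p) {X : ℝ → EuclideanSpace ℝ (Fin d)}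
    (hX : ContinuousOn X (Icc 0 T)) (hfin : VG T p (α * p + 1) X ≠ ⊤) :
    VG T p (α * p + 1) X ≤ ENNReal.ofReal (pathSobNorm d T α p X) ^ p := by
  have hc := (ext_cont hT hX).measurable
  rw [← VG_ext, VG_eq hp.le] at hfin ⊢
  rw [II_eq_ofReal _ (gag_nonneg p _ (ext T X)) (by fun_prop) hfin,
    ENNReal.ofReal_rpow_of_nonneg (norm_nonneg' T α p X) hp.le]
  apply ENNReal.ofReal_le_ofReal
  rw [dint_congr (g := fun u v => ‖X u - X v‖ ^ p / |v - u| ^ (α * p + 1))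
    (fun s hs t ht => by rw [ext_eq X hs, ext_eq X ht])]
  have h := gag_le_norm T α p X
  have h0 := dint_nonneg (T := T) (gag_nonneg p (α * p + 1) X)
  calc _ = ((∫ u in Icc (0:ℝ) T, ∫ v in Icc (0:ℝ) T,
      ‖X u - X v‖ ^ p / |v - u| ^ (α * p + 1)) ^ (1/p)) ^ p := by
        rw [← Real.rpow_mul h0, one_div_mul_cancel hp.ne', Real.rpow_one]
    _ ≤ _ := by gcongr

lemma VG_fin {d : ℕ} {T α p : ℝ} (hp : 0 < p) {X : ℝ → EuclideanSpace ℝ (Fin d)}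
    (hX : InPathSpace d T α p X) : VG T p (α * p + 1) X ≠ ⊤ := by
  rw [VG_eq hp.le]
  exact hX.2.1.ne

lemma bb_cont {d : ℕ} {T p γ : ℝ} (hT : 0 < T) (hp : 1 < p) (hγ : 2 < γ)
    {X : ℝ → EuclideanSpace ℝ (Fin d)} (hX : Continuous X) (hG : VG T p γ X ≠ ⊤) :
    ContinuousOn (bb T X) (Icc 0 T) := by
  have cX : ∀ i, Continuous fun u => X u i := fun i => by fun_prop
  have g : ∀ i, GG T p γ (fun u => X u i) ≠ ⊤ := fun i =>
    ne_top_of_le_ne_top hG (GG_le_VG (by linarith) X i)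
  refine continuousOn_pi.2 fun i => continuousOn_pi.2 fun j => ?_
  rcases lt_trichotomy i j with h | h | h
  · simp only [bb, Matrix.of_apply, if_pos h]
    exact para_cont hT hp hγ (cX i) (cX j) (g j)
  · simp only [bb, Matrix.of_apply, h, lt_irrefl, if_false, if_true]
    exact (((cX j).mul (cX j)).div_const 2).continuousOn
  · simp only [bb, Matrix.of_apply, if_neg h.not_gt, if_neg h.ne']
    exact ((cX i).mul (cX j)).continuousOn.sub (para_cont hT hp hγ (cX j) (cX i) (g i))

lemma secondIncr_zero {d : ℕ} (T s t : ℝ) (i j : Fin d) :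
    secondIncr d (fun _ => 0) (bb T (fun _ => 0)) s t i j = 0 := by
  have h : ∀ t, para T (fun _ => (0:ℝ)) (fun _ => (0:ℝ)) t = 0 := by
    intro t; simp [para, av]
  simp [secondIncr, bb, h]

end SobLift
/-- Local Lipschitz continuity of the Sobolev rough path lifting map (Theorem 3.12):
there is a map `L` assigning to each `X ∈ W^α_p([0,T];ℝ^d)` a weakly geometric Sobolev
rough path lift `L(X) = (a, b)` of `X`, which is locally Lipschitz continuous with
respect to the inhomogeneous Sobolev rough path metric `ρ_{W^α_p}`. -/
theorem lifting_map_locally_lipschitz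
    (hd : 0 < d) (T α p : ℝ) (hT : 0 < T)
    (hα : α ∈ Set.Ioo (1/3 : ℝ) (1/2)) (hp : 1 < p) (hαp : 1 / p < α) :
    ∃ L : (ℝ → EuclideanSpace ℝ (Fin d)) →
        (ℝ → EuclideanSpace ℝ (Fin d)) × (ℝ → Matrix (Fin d) (Fin d) ℝ),
      (∀ X, InPathSpace d T α p X →
        ContinuousOn (L X).1 (Icc 0 T) ∧ ContinuousOn (L X).2 (Icc 0 T) ∧
        (∀ t ∈ Icc (0:ℝ) T, ∀ i j,
          (L X).2 t i j + (L X).2 t j i = (L X).1 t i * (L X).1 t j) ∧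
        (∀ t ∈ Icc (0:ℝ) T, (L X).1 t - (L X).1 0 = X t - X 0) ∧
        (∫⁻ s in Icc (0:ℝ) T, ∫⁻ t in Icc (0:ℝ) T,
          ENNReal.ofReal
            ((‖(L X).1 t - (L X).1 s‖ ^ p
              + (Real.sqrt (∑ i, ∑ j, (secondIncr d (L X).1 (L X).2 s t i j) ^ 2))
                  ^ (p/2)) / |t - s| ^ (α * p + 1)) < ⊤)) ∧
      ∀ R : ℝ, 0 < R → ∃ C : ℝ, 0 < C ∧
        ∀ X X' : ℝ → EuclideanSpace ℝ (Fin d),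
          InPathSpace d T α p X → InPathSpace d T α p X' →
          pathSobNorm d T α p X ≤ R → pathSobNorm d T α p X' ≤ R →
          rhoSob d T α p (L X).1 (L X).2 (L X').1 (L X').2
            ≤ C * pathSobNorm d T α p (fun t => X t - X' t) := by
  obtain ⟨hα1, hα2⟩ := hα
  have hp0 : 0 < p := by linarith
  have hα0 : 0 < α := by linarith
  have hαp' : 1 < α * p := by rwa [div_lt_iff₀ hp0] at hαp
  have hp2 : 2 < p := by
    by_contra h
    push Not at h
    have : α * p ≤ α * 2 := by gcongr
    linarith
  have hq0 : 0 ≤ p / 2 := by linarith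
  refine ⟨fun X => (SobLift.ext T X, SobLift.bb T (SobLift.ext T X)), ?_, ?_⟩
  · intro X hX
    have cX := SobLift.ext_cont hT hX.1
    have fX := SobLift.VG_fin hp0 hX
    have fX' : SobLift.VG T p (α * p + 1) (SobLift.ext T X) ≠ ⊤ := by rwa [SobLift.VG_ext]
    refine ⟨cX.continuousOn, SobLift.bb_cont hT hp (by linarith) cX fX',
      fun t _ i j => SobLift.bb_symm T _ t i j, ?_, ?_⟩
    · intro t ht
      have h0 : (0:ℝ) ∈ Icc (0:ℝ) T := ⟨le_rfl, hT.le⟩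
      simp only
      rw [SobLift.ext_eq X ht, SobLift.ext_eq X h0]
    · simp only
      set Y := SobLift.ext T X with hY
      have hV := SobLift.VG_le hT hp0 hX.1 fX
      rw [← SobLift.VG_ext, ← hY] at hV
      set R := pathSobNorm d T α p X with hR
      have hR0 : 0 ≤ R := SobLift.norm_nonneg' T α p X
      obtain ⟨C, hC, hcore⟩ := SobLift.core (d := d) hT hα0 hα2 hp2 hαp' R
      have hz : SobLift.VG T p (α * p + 1) (fun _ => (0 : EuclideanSpace ℝ (Fin d)))
          ≤ ENNReal.ofReal R ^ p := by
        simp [SobLift.VG, SobLift.II, ENNReal.zero_rpow_of_pos hp0]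
      have h2 := hcore Y (fun _ => 0) cX continuous_const (R + 1) (by linarith) (by
        simp only [sub_zero]
        refine hV.trans ?_
        gcongr
        linarith) hV hz
      simp only [SobLift.secondIncr_zero, sub_zero] at h2
      have key := SobLift.II_add_le (T := T) (c := 1)
        (f := fun s t => ‖Y s - Y t‖ₑ ^ p * SobLift.hk (α * p + 1) s t)
        (g := fun s t => ENNReal.ofReal (Real.sqrt (∑ i, ∑ j,
          (secondIncr d Y (SobLift.bb T Y) s t i j) ^ 2)) ^ (p / 2) * SobLift.hk (α * p + 1) s t)
        (h := fun s t => ENNReal.ofReal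
            ((‖Y t - Y s‖ ^ p
              + (Real.sqrt (∑ i, ∑ j, (secondIncr d Y (SobLift.bb T Y) s t i j) ^ 2))
                  ^ (p/2)) / |t - s| ^ (α * p + 1))) (by simp)
        (by
          have hm := cX.measurable
          apply Measurable.mul _ (SobLift.hk_meas _)
          fun_prop)
        (by
          intro s _ t _
          rw [one_mul, add_div, ENNReal.ofReal_add (by positivity) (by positivity),
            SobLift.ofReal_div (norm_nonneg _) (abs_nonneg _) hp0.le,
            SobLift.ofReal_div (Real.sqrt_nonneg _) (abs_nonneg _) hq0, ofReal_norm,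
            enorm_sub_rev (Y t)]
          exact le_rfl)
      refine lt_of_le_of_lt key ?_
      rw [one_mul]
      refine ENNReal.add_lt_top.2 ⟨fX'.lt_top, lt_of_le_of_lt h2 ?_⟩
      exact ENNReal.mul_lt_top hC.lt_top
        (ENNReal.rpow_ne_top_of_nonneg hq0 ENNReal.ofReal_ne_top).lt_top
  · intro R hR
    obtain ⟨C, hC, hcore⟩ := SobLift.core (d := d) hT hα0 hα2 hp2 hαp' R
    have hK0 : 0 ≤ C.toReal ^ (2/p) := Real.rpow_nonneg ENNReal.toReal_nonneg _
    refine ⟨1 + C.toReal ^ (2/p), by linarith, ?_⟩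
    intro X X' hX hX' hXR hXR'
    have cX := SobLift.ext_cont hT hX.1
    have cX' := SobLift.ext_cont hT hX'.1
    have fX := SobLift.VG_fin hp0 hX
    have fX' := SobLift.VG_fin hp0 hX'
    have eV : SobLift.VG T p (α * p + 1) (fun u => SobLift.ext T X u - SobLift.ext T X' u)
        = SobLift.VG T p (α * p + 1) (fun u => X u - X' u) :=
      SobLift.VG_ext (fun u => X u - X' u)
    have fD : SobLift.VG T p (α * p + 1) (fun u => X u - X' u) ≠ ⊤ := by
      rw [← eV]
      refine ne_top_of_le_ne_top ?_ (SobLift.VG_sub hp0.le cX)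
      rw [SobLift.VG_ext, SobLift.VG_ext]
      have : (2:ENNReal) ^ p ≠ ⊤ := ENNReal.rpow_ne_top_of_nonneg hp0.le (by norm_num)
      finiteness
    have vD := SobLift.VG_le hT hp0 (hX.1.sub hX'.1) fD
    have vX := SobLift.VG_le hT hp0 hX.1 fX
    have vX' := SobLift.VG_le hT hp0 hX'.1 fX'
    have gD := SobLift.gag_le_norm T α p (fun t => X t - X' t)
    have nD := SobLift.norm_nonneg' T α p (fun t => X t - X' t)
    set N := pathSobNorm d T α p (fun t => X t - X' t) with hN
    have vD' : SobLift.VG T p (α * p + 1) (fun u => X u - X' u) ≤ ENNReal.ofReal N ^ p := vD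
    unfold rhoSob
    rw [add_mul, one_mul]
    apply add_le_add
    · refine le_trans (le_of_eq ?_) gD
      congr 1
      apply SobLift.dint_congr
      intro s hs t ht
      simp only
      rw [SobLift.ext_eq X hs, SobLift.ext_eq X ht, SobLift.ext_eq X' hs, SobLift.ext_eq X' ht,
        ← norm_neg]
      congr 3
      abel
    · simp only
      set Y := SobLift.ext T X with hY
      set Y' := SobLift.ext T X' with hY'
      set f : ℝ → ℝ → ℝ := fun s t => (Real.sqrt (∑ i, ∑ j,
          (secondIncr d Y (SobLift.bb T Y) s t i j
            - secondIncr d Y' (SobLift.bb T Y') s t i j) ^ 2)) ^ (p/2)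
          / |t - s| ^ (α * p + 1) with hf
      have f0 : ∀ s t, 0 ≤ f s t := fun s t => by simp only [hf]; positivity
      have I0 := SobLift.dint_nonneg (T := T) f0
      change (∫ s in Icc (0:ℝ) T, ∫ t in Icc (0:ℝ) T, f s t) ^ (2/p) ≤ C.toReal ^ (2/p) * N
      have step : ∀ δ, N < δ →
          (∫ s in Icc (0:ℝ) T, ∫ t in Icc (0:ℝ) T, f s t) ^ (2/p) ≤ C.toReal ^ (2/p) * δ := by
        intro δ hδ
        have hδ0 : 0 < δ := lt_of_le_of_lt nD hδ
        have h1 := hcore Y Y' cX cX' δ hδ0 (by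
            rw [eV]
            refine vD'.trans ?_
            gcongr)
          (by
            rw [hY, SobLift.VG_ext]
            refine vX.trans ?_
            gcongr)
          (by
            rw [hY', SobLift.VG_ext]
            refine vX'.trans ?_
            gcongr)
        have h2 : ENNReal.ofReal (∫ s in Icc (0:ℝ) T, ∫ t in Icc (0:ℝ) T, f s t)
            ≤ C * ENNReal.ofReal δ ^ (p/2) := by
          refine (SobLift.ofReal_dint_le f f0).trans (le_trans (le_of_eq ?_) h1)
          apply SobLift.II_congr
          intro s _ t _
          exact SobLift.ofReal_div (Real.sqrt_nonneg _) (abs_nonneg _) hq0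
        have h3 : ∫ s in Icc (0:ℝ) T, ∫ t in Icc (0:ℝ) T, f s t ≤ C.toReal * δ ^ (p/2) := by
          rw [← ENNReal.ofReal_toReal hC, ENNReal.ofReal_rpow_of_pos hδ0,
            ← ENNReal.ofReal_mul ENNReal.toReal_nonneg] at h2
          exact (ENNReal.ofReal_le_ofReal_iff
            (mul_nonneg ENNReal.toReal_nonneg (Real.rpow_nonneg hδ0.le _))).1 h2
        calc _ ≤ (C.toReal * δ ^ (p/2)) ^ (2/p) := by
              apply Real.rpow_le_rpow I0 h3 (by positivity)
          _ = _ := by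
              rw [Real.mul_rpow ENNReal.toReal_nonneg (Real.rpow_nonneg hδ0.le _),
                ← Real.rpow_mul hδ0.le]
              have : p / 2 * (2 / p) = 1 := by field_simp
              rw [this, Real.rpow_one]
      refine le_of_forall_pos_le_add fun ε hε => ?_
      have hK1 : 0 < C.toReal ^ (2/p) + 1 := by linarith
      have := step (N + ε / (C.toReal ^ (2/p) + 1)) (by
        have : 0 < ε / (C.toReal ^ (2/p) + 1) := by positivity
        linarith)
      refine this.trans ?_
      rw [mul_add]
      gcongr
      rw [mul_div_assoc', div_le_iff₀ hK1]
      nlinarith
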